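/- Let A be a unital C*-algebra. The following are equivalent: (i) A has the Dixmier property; (ii) A is weakly central and, for every maximal closed two-sided ideal M of A, (a) the quotient A/(M ∩ Z(A))A has at most one tracial state, and (b) if A/(M ∩ Z(A))A has a tracial state τ, then τ vanishes on the ideal M/(M ∩ Z(A))A; (iii) A is weakly central, for every maximal closed two-sided ideal M of A the quotient A/M has at most one tracial state, and every extreme tracial state of A factors through A/M for some maximal ideal M (i.e., vanishes on M). -/

import Mathlib

open scoped ComplexOrder

noncomputable section

variable {A : Type*} [CStarAlgebra A]

/-- A tracial state on a C*-algebra: a positive linear functional of norm 1 with the trace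
property. -/
def IsTracialState (τ : A →L[ℂ] ℂ) : Prop :=
  ‖τ‖ = 1 ∧ (∀ a : A, 0 ≤ τ (star a * a)) ∧ ∀ a b : A, τ (a * b) = τ (b * a)

/-- An extreme point of the convex set of tracial states. -/
def IsExtremeTracialState (τ : A →L[ℂ] ℂ) : Prop :=
  IsTracialState τ ∧ ∀ τ₁ τ₂ : A →L[ℂ] ℂ, IsTracialState τ₁ → IsTracialState τ₂ →
    ∀ t : ℝ, 0 < t → t < 1 → (∀ a : A, τ a = t * τ₁ a + (1 - t) * τ₂ a) → τ₁ = τ ∧ τ₂ = τ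

/-- A closed two-sided ideal of a C*-algebra, regarded as a `ℂ`-submodule. -/
def IsClosedTwoSidedIdeal (I : Submodule ℂ A) : Prop :=
  IsClosed (I : Set A) ∧ ∀ a b : A, b ∈ I → a * b ∈ I ∧ b * a ∈ I

/-- A maximal (proper, closed, two-sided) ideal of a C*-algebra. -/
def IsMaximalClosedIdeal (M : Submodule ℂ A) : Prop :=
  IsClosedTwoSidedIdeal M ∧ M ≠ ⊤ ∧
    ∀ J : Submodule ℂ A, IsClosedTwoSidedIdeal J → J ≠ ⊤ → M ≤ J → J = M

/-- The Dixmier set of `a`: the norm-closed convex hull of the unitary conjugates of `a`. -/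
def dixmierSet (a : A) : Set A :=
  closure (convexHull ℝ {b : A | ∃ u : unitary A, b = (u : A) * a * star (u : A)})

/-- The Dixmier property. -/
def DixmierProperty (A : Type*) [CStarAlgebra A] : Prop :=
  ∀ a : A, (dixmierSet a ∩ Set.center A).Nonempty

/-- Weak centrality: the map `M ↦ M ∩ Z(A)` on maximal closed two-sided ideals is injective. -/
def WeaklyCentral (A : Type*) [CStarAlgebra A] : Prop :=
  ∀ M₁ M₂ : Submodule ℂ A, IsMaximalClosedIdeal M₁ → IsMaximalClosedIdeal M₂ →
    (M₁ : Set A) ∩ Set.center A = (M₂ : Set A) ∩ Set.center A → M₁ = M₂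

/-- The Glimm ideal `(M ∩ Z(A))A`: the closed two-sided ideal of `A` generated by
`M ∩ Z(A)`. -/
def glimmSet (M : Submodule ℂ A) : Set A :=
  closure (Submodule.span ℂ {x : A | ∃ z ∈ (M : Set A) ∩ Set.center A, ∃ y : A, x = z * y} : Set A)

section PositiveFunctionals

/-- Positivity of a functional, expressed on elements of the form `star a * a`. -/
def IsPos (f : A →L[ℂ] ℂ) : Prop := ∀ a : A, 0 ≤ f (star a * a)

namespace IsPos

variable {f : A →L[ℂ] ℂ}

theorem im_one (hf : IsPos f) : (f 1).im = 0 := by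
  have := (Complex.le_def.mp (hf 1)).2
  simpa using this.symm

theorem apply_real_smul (f : A →L[ℂ] ℂ) (r : ℝ) (x : A) : f (r • x) = r * f x := by
  rw [← Complex.coe_smul, map_smul, smul_eq_mul]

/-- The functional `x ↦ f (star w * x * w)`. -/
def conj (f : A →L[ℂ] ℂ) (w : A) : A →L[ℂ] ℂ :=
  f ∘L ((ContinuousLinearMap.mul ℂ A).flip w) ∘L (ContinuousLinearMap.mul ℂ A (star w))

@[simp] theorem conj_apply (f : A →L[ℂ] ℂ) (w x : A) : conj f w x = f (star w * x * w) := by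
  simp [conj]

theorem isPos_conj (hf : IsPos f) (w : A) : IsPos (conj f w) := fun a => by
  simpa [mul_assoc] using hf (a * w)

theorem ext_re {g : A →L[ℂ] ℂ} (h : ∀ x : A, (f x).re = (g x).re) : f = g := by
  ext x
  apply Complex.ext (h x)
  have := h (Complex.I • x)
  rw [map_smul, map_smul] at this
  simpa using this

end IsPos

theorem IsTracialState.isPos {τ : A →L[ℂ] ℂ} (h : IsTracialState τ) : IsPos τ := h.2.1

theorem trace_of_star_mul {τ : A →L[ℂ] ℂ} (h : ∀ a : A, τ (star a * a) = τ (a * star a))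
    (a b : A) : τ (a * b) = τ (b * a) := by
  have h1 := h (star a + b)
  have h2 := h (Complex.I • star a + b)
  have h3 := h (star a)
  have h4 := h b
  have h3' := h a
  simp only [star_add, star_star, star_smul, mul_add, add_mul, map_add, smul_mul_assoc,
    mul_smul_comm, map_smul, smul_eq_mul, Complex.star_def, Complex.conj_I] at h1 h2 h3
  rw [h3, h4] at h1
  rw [h3, h4] at h2
  have hI : Complex.I * Complex.I = -1 := Complex.I_mul_I
  linear_combination (1/2) * h1 + (Complex.I/2) * h2 + (τ (a * b) / 2 - τ (b * a) / 2
    - τ (star b * star a) / 2 + τ (star a * star b) / 2) * hI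

variable [PartialOrder A] [StarOrderedRing A]

namespace IsPos

variable {f : A →L[ℂ] ℂ}

theorem nonneg (hf : IsPos f) {x : A} (hx : 0 ≤ x) : 0 ≤ f x := by
  obtain ⟨b, rfl⟩ := CStarAlgebra.nonneg_iff_eq_star_mul_self.mp hx
  exact hf b

theorem mono (hf : IsPos f) {x y : A} (h : x ≤ y) : f x ≤ f y := by
  have := hf.nonneg (sub_nonneg.mpr h)
  rwa [map_sub, sub_nonneg] at this

theorem re_nonneg (hf : IsPos f) {x : A} (hx : 0 ≤ x) : 0 ≤ (f x).re :=
  (Complex.le_def.mp (hf.nonneg hx)).1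

theorem re_mono (hf : IsPos f) {x y : A} (h : x ≤ y) : (f x).re ≤ (f y).re :=
  (Complex.le_def.mp (hf.mono h)).1

theorem one_nonneg (hf : IsPos f) : 0 ≤ (f 1).re :=
  hf.re_nonneg (by simp)

theorem im_eq_zero (hf : IsPos f) {x : A} (hx : IsSelfAdjoint x) : (f x).im = 0 := by
  have h := (Complex.le_def.mp (hf.mono hx.le_algebraMap_norm_self)).2
  rw [Algebra.algebraMap_eq_smul_one, apply_real_smul] at h
  simpa [hf.im_one] using h

theorem apply_star (hf : IsPos f) (x : A) : f (star x) = star (f x) := by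
  have h1 := hf.im_eq_zero (realPart x).2
  have h2 := hf.im_eq_zero (imaginaryPart x).2
  have h3 : f x = f (realPart x) + Complex.I * f (imaginaryPart x) := by
    conv_lhs => rw [← realPart_add_I_smul_imaginaryPart x]
    simp
  have h4 : f (star x) = f (realPart x) - Complex.I * f (imaginaryPart x) := by
    conv_lhs => rw [← realPart_add_I_smul_imaginaryPart x]
    simp [selfAdjoint.star_val_eq, sub_eq_add_neg]
  rw [h3, h4]
  apply Complex.ext <;> simp [h1, h2]

theorem re_realPart (hf : IsPos f) (x : A) : (f (realPart x)).re = (f x).re := by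
  have h2 := hf.im_eq_zero (imaginaryPart x).2
  conv_rhs => rw [← realPart_add_I_smul_imaginaryPart x]
  simp [h2]

theorem re_le_norm (hf : IsPos f) (x : A) : (f x).re ≤ ‖x‖ * (f 1).re := by
  rw [← hf.re_realPart x]
  have h := hf.re_mono (realPart x).2.le_algebraMap_norm_self
  rw [Algebra.algebraMap_eq_smul_one, apply_real_smul] at h
  have h5 : ‖(realPart x : A)‖ ≤ ‖x‖ := realPart.norm_le x
  refine h.trans ?_
  rw [Complex.re_ofReal_mul]
  exact mul_le_mul_of_nonneg_right h5 hf.one_nonneg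

theorem norm_apply_le (hf : IsPos f) (x : A) : ‖f x‖ ≤ ‖x‖ * (f 1).re := by
  by_cases h0 : f x = 0
  · rw [h0, norm_zero]; exact mul_nonneg (norm_nonneg _) hf.one_nonneg
  have hn : (‖f x‖ : ℂ) ≠ 0 := by simpa using h0
  have h := hf.re_le_norm ((star (f x) / ‖f x‖ : ℂ) • x)
  have h1 : ‖(star (f x) / ‖f x‖ : ℂ)‖ = 1 := by
    rw [norm_div, norm_star, Complex.norm_real, norm_norm, div_self (by simpa using h0)]
  rw [norm_smul, h1, one_mul, map_smul, smul_eq_mul] at h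
  have h2 : (star (f x) / ‖f x‖ : ℂ) * f x = ‖f x‖ := by
    rw [div_mul_eq_mul_div, div_eq_iff hn]
    simpa [sq] using Complex.conj_mul' (f x)
  rwa [h2, Complex.ofReal_re] at h

theorem norm_eq (hf : IsPos f) : ‖f‖ = (f 1).re := by
  apply le_antisymm
  · exact f.opNorm_le_bound hf.one_nonneg fun x => by
      rw [mul_comm]; exact hf.norm_apply_le x
  · rcases subsingleton_or_nontrivial A with h | h
    · rw [Subsingleton.elim (1 : A) 0]; simp
    · calc (f 1).re ≤ ‖f 1‖ := Complex.re_le_norm _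
        _ ≤ ‖f‖ * ‖(1 : A)‖ := f.le_opNorm 1
        _ = ‖f‖ := by rw [norm_one, mul_one]

theorem of_re (h1 : ∀ x : A, 0 ≤ x → 0 ≤ (f x).re)
    (h2 : ∀ x : A, IsSelfAdjoint x → (f (Complex.I • x)).re = 0) : IsPos f := fun a => by
  rw [Complex.le_def]
  refine ⟨h1 _ (star_mul_self_nonneg a), ?_⟩
  have := h2 _ (IsSelfAdjoint.star_mul_self a)
  rw [map_smul] at this
  simpa [eq_comm] using this

end IsPos

theorem IsTracialState.map_one {τ : A →L[ℂ] ℂ} (h : IsTracialState τ) : τ 1 = 1 := by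
  apply Complex.ext
  · rw [← h.isPos.norm_eq, h.1]; rfl
  · rw [h.isPos.im_one]; rfl

theorem isTracialState_of_isPos {τ : A →L[ℂ] ℂ} (h : IsPos τ) (h1 : τ 1 = 1)
    (h2 : ∀ a b : A, τ (a * b) = τ (b * a)) : IsTracialState τ :=
  ⟨by rw [h.norm_eq, h1]; rfl, h, h2⟩

end PositiveFunctionals

section Ideals

/-- A (not necessarily closed) two-sided ideal, as a `ℂ`-submodule. -/
def IsIdeal (I : Submodule ℂ A) : Prop := ∀ a b : A, b ∈ I → a * b ∈ I ∧ b * a ∈ I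

theorem IsIdeal.sup {I J : Submodule ℂ A} (hI : IsIdeal I) (hJ : IsIdeal J) : IsIdeal (I ⊔ J) := by
  intro a b hb
  obtain ⟨x, hx, y, hy, rfl⟩ := Submodule.mem_sup.mp hb
  rw [mul_add, add_mul]
  exact ⟨Submodule.add_mem_sup (hI a x hx).1 (hJ a y hy).1,
    Submodule.add_mem_sup (hI a x hx).2 (hJ a y hy).2⟩

theorem isIdeal_span {S : Set A} (hS : ∀ a, ∀ b ∈ S, a * b ∈ S ∧ b * a ∈ S) :
    IsIdeal (Submodule.span ℂ S) := by
  intro a b hb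
  induction hb using Submodule.span_induction with
  | mem x hx =>
    exact ⟨Submodule.subset_span (hS a x hx).1, Submodule.subset_span (hS a x hx).2⟩
  | zero => simp
  | add x y _ _ hx hy =>
    rw [mul_add, add_mul]
    exact ⟨Submodule.add_mem _ hx.1 hy.1, Submodule.add_mem _ hx.2 hy.2⟩
  | smul c x _ hx =>
    rw [mul_smul_comm, smul_mul_assoc]
    exact ⟨Submodule.smul_mem _ _ hx.1, Submodule.smul_mem _ _ hx.2⟩

theorem IsIdeal.topologicalClosure {I : Submodule ℂ A} (hI : IsIdeal I) :
    IsIdeal I.topologicalClosure := by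
  intro a b hb
  constructor
  · exact map_mem_closure (f := fun x => a * x) (by fun_prop) hb fun x hx => (hI a x hx).1
  · exact map_mem_closure (f := fun x => x * a) (by fun_prop) hb fun x hx => (hI a x hx).2

theorem IsIdeal.isClosedTwoSidedIdeal {I : Submodule ℂ A} (hI : IsIdeal I) :
    IsClosedTwoSidedIdeal I.topologicalClosure :=
  ⟨I.isClosed_topologicalClosure, hI.topologicalClosure⟩

theorem IsIdeal.eq_top {I : Submodule ℂ A} (hI : IsIdeal I) (h : (1 : A) ∈ I) : I = ⊤ :=
  eq_top_iff.mpr fun x _ => by simpa using (hI x 1 h).1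

theorem IsIdeal.one_mem_of_closure {I : Submodule ℂ A} (hI : IsIdeal I)
    (h : (1 : A) ∈ I.topologicalClosure) : (1 : A) ∈ I := by
  obtain ⟨y, hy, hd⟩ := Metric.mem_closure_iff.mp h 1 one_pos
  rw [dist_eq_norm] at hd
  have hu : IsUnit y := by
    have := (Units.oneSub (1 - y) hd).isUnit
    simpa using this
  obtain ⟨u, rfl⟩ := hu
  simpa using (hI (↑u⁻¹ : A) _ hy).1

theorem IsMaximalClosedIdeal.isIdeal {M : Submodule ℂ A} (hM : IsMaximalClosedIdeal M) :
    IsIdeal M := hM.1.2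

theorem IsMaximalClosedIdeal.one_notMem {M : Submodule ℂ A} (hM : IsMaximalClosedIdeal M) :
    (1 : A) ∉ M := fun h => hM.2.1 (hM.isIdeal.eq_top h)

theorem IsMaximalClosedIdeal.eq_of_le {M J : Submodule ℂ A} (hM : IsMaximalClosedIdeal M)
    (hJ : IsIdeal J) (h1 : (1 : A) ∉ J) (hle : M ≤ J) : J = M := by
  refine le_antisymm ?_ hle
  have := hM.2.2 J.topologicalClosure hJ.isClosedTwoSidedIdeal
    (fun h => h1 (hJ.one_mem_of_closure (h ▸ Submodule.mem_top)))
    (hle.trans J.le_topologicalClosure)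
  exact J.le_topologicalClosure.trans this.le

theorem IsMaximalClosedIdeal.exists_add_eq_one {M J : Submodule ℂ A} (hM : IsMaximalClosedIdeal M)
    (hJ : IsIdeal J) (hle : ¬ J ≤ M) : ∃ m ∈ M, ∃ x ∈ J, m + x = 1 := by
  by_contra hcon
  refine hle ?_
  rw [← hM.eq_of_le (hM.isIdeal.sup hJ) (fun h => hcon ?_) le_sup_left]
  · exact le_sup_right
  · obtain ⟨m, hm, x, hx, h⟩ := Submodule.mem_sup.mp h
    exact ⟨m, hm, x, hx, h⟩

theorem IsIdeal.exists_maximal {I : Submodule ℂ A} (hI : IsIdeal I) (h : (1 : A) ∉ I) :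
    ∃ M : Submodule ℂ A, IsMaximalClosedIdeal M ∧ I ≤ M := by
  obtain ⟨M, hIM, hM⟩ := zorn_le_nonempty₀ {J : Submodule ℂ A | IsIdeal J ∧ (1 : A) ∉ J}
    (fun c hc hchain y hy => by
      have hne : c.Nonempty := ⟨y, hy⟩
      have hdir : DirectedOn (· ≤ ·) c := hchain.directedOn
      refine ⟨sSup c, ⟨fun a b hb => ?_, fun h1 => ?_⟩, fun z hz => le_sSup hz⟩
      · obtain ⟨J, hJ, hbJ⟩ := (Submodule.mem_sSup_of_directed hne hdir).mp hb
        exact ⟨le_sSup hJ ((hc hJ).1 a b hbJ).1, le_sSup hJ ((hc hJ).1 a b hbJ).2⟩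
      · obtain ⟨J, hJ, hbJ⟩ := (Submodule.mem_sSup_of_directed hne hdir).mp h1
        exact (hc hJ).2 hbJ) I ⟨hI, h⟩
  have hcl : M.topologicalClosure = M := le_antisymm
    (hM.2 ⟨hM.1.1.topologicalClosure, fun h1 => hM.1.2 (hM.1.1.one_mem_of_closure h1)⟩
      M.le_topologicalClosure) M.le_topologicalClosure
  refine ⟨M, ⟨hcl ▸ hM.1.1.isClosedTwoSidedIdeal, fun h => hM.1.2 (h ▸ Submodule.mem_top),
    fun J hJ hne hle => ?_⟩, hIM⟩
  exact le_antisymm (hM.2 ⟨hJ.2, fun h1 => hne (IsIdeal.eq_top hJ.2 h1)⟩ hle) hle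

/-- The algebraic two-sided ideal generated by one element. -/
def principalIdeal (d : A) : Submodule ℂ A := Submodule.span ℂ {x | ∃ a b : A, x = a * d * b}

theorem isIdeal_principalIdeal (d : A) : IsIdeal (principalIdeal d) := by
  refine isIdeal_span ?_
  rintro a _ ⟨x, y, rfl⟩
  exact ⟨⟨a * x, y, by simp [mul_assoc]⟩, ⟨x, y * a, by simp [mul_assoc]⟩⟩

theorem mem_principalIdeal (d : A) : d ∈ principalIdeal d :=
  Submodule.subset_span ⟨1, 1, by simp⟩

end Ideals

section CutOff

/-- The positive part `(b - t)₊`. -/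
def above (b : A) (t : ℝ) : A := cfc (fun s : ℝ => max (s - t) 0) b

/-- The positive part `(t - b)₊`. -/
def below (b : A) (t : ℝ) : A := cfc (fun s : ℝ => max (t - s) 0) b

theorem above_sub_below {b : A} (hb : IsSelfAdjoint b) (t : ℝ) :
    above b t - below b t = b - t • (1 : A) := by
  rw [above, below, ← cfc_sub _ _ b]
  have : (fun s : ℝ => max (s - t) 0 - max (t - s) 0) = fun s => s - t := by
    ext s; rcases le_total s t with h | h
    · rw [max_eq_right (by linarith), max_eq_left (by linarith)]; ring
    · rw [max_eq_left (by linarith), max_eq_right (by linarith)]; ring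
  rw [this, cfc_sub _ _ b, cfc_id' ℝ b, cfc_const t b, Algebra.algebraMap_eq_smul_one]

theorem below_mul_above (b : A) (t : ℝ) : below b t * above b t = 0 := by
  nontriviality A
  rw [above, below, ← cfc_mul _ _ b]
  have : (fun s : ℝ => max (t - s) 0 * max (s - t) 0) = fun _ => 0 := by
    ext s; rcases le_total s t with h | h
    · rw [max_eq_right (a := s - t) (by linarith), mul_zero]
    · rw [max_eq_right (a := t - s) (by linarith), zero_mul]
  rw [this]
  simp

theorem below_neg {b : A} (hb : IsSelfAdjoint b) (t : ℝ) : below (-b) (-t) = above b t := by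
  rw [above, below, ← cfc_comp_neg _ b]
  congr 1; ext s; ring_nf

theorem continuous_above (b : A) : Continuous (above b) := by
  refine (LipschitzWith.of_dist_le_mul (K := 1) fun t t' => ?_).continuous
  by_cases hb : IsSelfAdjoint b
  · rw [dist_eq_norm, above, above, ← cfc_sub _ _ b, NNReal.coe_one, one_mul]
    refine norm_cfc_le dist_nonneg fun s _ => ?_
    rw [Real.dist_eq, Real.norm_eq_abs]
    refine (abs_max_sub_max_le_abs _ _ _).trans (le_of_eq ?_)
    rw [← abs_neg]; congr 1; ring
  · rw [above, above, cfc_apply_of_not_predicate _ hb, cfc_apply_of_not_predicate _ hb]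
    simp

theorem continuous_below (b : A) : Continuous (below b) := by
  by_cases hb : IsSelfAdjoint b
  · have : below b = fun t => above b t - (b - t • (1 : A)) := by
      ext t; rw [← above_sub_below hb]; abel
    rw [this]
    exact (continuous_above b).sub (by fun_prop)
  · have : below b = fun _ => 0 := by
      ext t; exact cfc_apply_of_not_predicate _ hb
    rw [this]; exact continuous_const

theorem above_eq_zero {b : A} {t : ℝ} (h : ‖b‖ ≤ t) : above b t = 0 := by
  nontriviality A
  rw [above, cfc_congr (g := fun _ => 0)]
  · simp
  · intro s hs
    have := (le_abs_self s).trans ((spectrum.norm_le_norm_of_mem hs).trans h)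
    exact max_eq_right (by linarith)

theorem below_eq_zero {b : A} {t : ℝ} (h : t ≤ -‖b‖) : below b t = 0 := by
  nontriviality A
  rw [below, cfc_congr (g := fun _ => 0)]
  · simp
  · intro s hs
    have := (neg_le_abs s).trans (spectrum.norm_le_norm_of_mem hs)
    exact max_eq_right (by linarith)

variable [PartialOrder A] [StarOrderedRing A]

theorem above_nonneg (b : A) (t : ℝ) : 0 ≤ above b t := cfc_nonneg fun _ _ => le_max_right _ _

theorem below_nonneg (b : A) (t : ℝ) : 0 ≤ below b t := cfc_nonneg fun _ _ => le_max_right _ _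

end CutOff

section Centre

theorem mul_comm_of_mem_center {z : A} (hz : z ∈ Set.center A) (x : A) : z * x = x * z :=
  (Semigroup.mem_center_iff.mp hz x).symm

theorem one_mem_center : (1 : A) ∈ Set.center A := Set.one_mem_center

theorem smul_mem_center (c : ℂ) {z : A} (hz : z ∈ Set.center A) : c • z ∈ Set.center A :=
  (Subalgebra.center ℂ A).smul_mem hz c

theorem real_smul_mem_center (c : ℝ) {z : A} (hz : z ∈ Set.center A) : c • z ∈ Set.center A := by
  rw [← Complex.coe_smul]; exact smul_mem_center _ hz

theorem add_mem_center {y z : A} (hy : y ∈ Set.center A) (hz : z ∈ Set.center A) :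
    y + z ∈ Set.center A := (Subalgebra.center ℂ A).add_mem hy hz

theorem sub_mem_center {y z : A} (hy : y ∈ Set.center A) (hz : z ∈ Set.center A) :
    y - z ∈ Set.center A := (Subalgebra.center ℂ A).sub_mem hy hz

theorem star_mem_center {z : A} (hz : z ∈ Set.center A) : star z ∈ Set.center A :=
  Set.star_mem_center hz

theorem realPart_mem_center {z : A} (hz : z ∈ Set.center A) : (realPart z : A) ∈ Set.center A := by
  rw [realPart_apply_coe]
  exact real_smul_mem_center _ (add_mem_center hz (star_mem_center hz))

theorem imaginaryPart_mem_center {z : A} (hz : z ∈ Set.center A) :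
    (imaginaryPart z : A) ∈ Set.center A := by
  rw [imaginaryPart_apply_coe]
  exact smul_mem_center _ (real_smul_mem_center _ (sub_mem_center hz (star_mem_center hz)))

theorem cfc_mem_center {z : A} (hz : z ∈ Set.center A) (f : ℝ → ℝ) :
    cfc f z ∈ Set.center A := by
  rw [Semigroup.mem_center_iff]
  intro g
  have h : Commute z g := mul_comm_of_mem_center hz g
  exact (h.cfc_real f).eq.symm

theorem IsMaximalClosedIdeal.exists_sub_real_smul_mem {M : Submodule ℂ A}
    (hM : IsMaximalClosedIdeal M) {z : A} (hz : z ∈ Set.center A) (hs : IsSelfAdjoint z) :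
    ∃ t : ℝ, z - t • (1 : A) ∈ M := by
  have hcov : ∀ t : ℝ, above z t ∈ M ∨ below z t ∈ M := by
    intro t
    by_contra! h
    obtain ⟨m, hm, x, hx, h1⟩ := hM.exists_add_eq_one (isIdeal_principalIdeal (below z t))
      (fun hle => h.2 (hle (mem_principalIdeal _)))
    have hz' : above z t ∈ Set.center A := cfc_mem_center hz _
    have hxa : ∀ x ∈ principalIdeal (below z t), x * above z t = 0 := by
      intro x hx
      induction hx using Submodule.span_induction with
      | mem x hx =>
        obtain ⟨a, b, rfl⟩ := hx
        rw [mul_assoc, ← mul_comm_of_mem_center hz', mul_assoc, ← mul_assoc (below z t),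
          below_mul_above, zero_mul, mul_zero]
      | zero => simp
      | add x y _ _ hx hy => rw [add_mul, hx, hy, add_zero]
      | smul c x _ hx => rw [smul_mul_assoc, hx, smul_zero]
    refine h.1 ?_
    have : above z t = m * above z t := by
      conv_lhs => rw [← one_mul (above z t), ← h1, add_mul, hxa x hx, add_zero]
    rw [this]
    exact (hM.isIdeal _ _ hm).2
  obtain ⟨t, -, h1, h2⟩ := isPreconnected_closed_iff.mp (isPreconnected_univ (α := ℝ))
    (above z ⁻¹' M) (below z ⁻¹' M) (hM.1.1.preimage (continuous_above z))
    (hM.1.1.preimage (continuous_below z)) (fun t _ => hcov t)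
    ⟨‖z‖, trivial, by simp [above_eq_zero le_rfl]⟩
    ⟨-‖z‖, trivial, by simp [below_eq_zero le_rfl]⟩
  exact ⟨t, by rw [← above_sub_below hs]; exact M.sub_mem h1 h2⟩

theorem IsMaximalClosedIdeal.exists_sub_smul_mem {M : Submodule ℂ A}
    (hM : IsMaximalClosedIdeal M) {z : A} (hz : z ∈ Set.center A) :
    ∃ c : ℂ, z - c • (1 : A) ∈ M := by
  obtain ⟨s, hs⟩ := hM.exists_sub_real_smul_mem (realPart_mem_center hz) (realPart z).2
  obtain ⟨t, ht⟩ := hM.exists_sub_real_smul_mem (imaginaryPart_mem_center hz) (imaginaryPart z).2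
  refine ⟨s + Complex.I * t, ?_⟩
  have := M.add_mem hs (M.smul_mem Complex.I ht)
  convert this using 1
  conv_lhs => rw [← realPart_add_I_smul_imaginaryPart z]
  rw [smul_sub, add_smul, mul_smul, Complex.coe_smul, Complex.coe_smul]
  abel

end Centre

section DixmierImpliesTraces

theorem dixmierSet_subset {a : A} {S : Set A} (hS : Convex ℝ S) (hc : IsClosed S)
    (h : ∀ u : unitary A, (u : A) * a * star (u : A) ∈ S) : dixmierSet a ⊆ S :=
  closure_minimal (convexHull_min (by rintro _ ⟨u, rfl⟩; exact h u) hS) hc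

theorem convex_dixmierSet (a : A) : Convex ℝ (dixmierSet a) := (convex_convexHull ℝ _).closure

theorem isClosed_dixmierSet (a : A) : IsClosed (dixmierSet a) := isClosed_closure

theorem conj_mem_dixmierSet (a : A) (u : unitary A) :
    (u : A) * a * star (u : A) ∈ dixmierSet a :=
  subset_closure (subset_convexHull ℝ _ ⟨u, rfl⟩)

theorem Submodule.convex_complex (M : Submodule ℂ A) : Convex ℝ (M : Set A) :=
  (M.restrictScalars ℝ).convex

theorem dixmierSet_subset_ideal {M : Submodule ℂ A} (hM : IsClosedTwoSidedIdeal M) {a : A}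
    (ha : a ∈ M) : dixmierSet a ⊆ M :=
  dixmierSet_subset M.convex_complex hM.1 fun _ => (hM.2 _ _ (hM.2 _ _ ha).1).2

theorem one_sub_mem_dixmierSet {a z : A} (hz : z ∈ dixmierSet a) :
    1 - z ∈ dixmierSet (1 - a) := by
  have hS : Convex ℝ ((fun b : A => 1 - b) ⁻¹' dixmierSet (1 - a)) := by
    intro x hx y hy s t hs ht hst
    have := convex_dixmierSet (1 - a) hx hy hs ht hst
    have h2 : s • (1 - x) + t • (1 - y) = 1 - (s • x + t • y) := by
      rw [smul_sub, smul_sub, sub_add_sub_comm, ← add_smul, hst, one_smul]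
    rw [h2] at this
    exact this
  refine dixmierSet_subset hS ((isClosed_dixmierSet _).preimage (by fun_prop)) (fun u => ?_) hz
  have := conj_mem_dixmierSet (1 - a) u
  rwa [mul_sub, sub_mul, mul_one, Unitary.mul_star_self_of_mem u.2] at this

theorem IsTracialState.apply_dixmierSet {τ : A →L[ℂ] ℂ} (hτ : IsTracialState τ) {a z : A}
    (hz : z ∈ dixmierSet a) : τ z = τ a := by
  have hS : Convex ℝ {b : A | τ b = τ a} := by
    intro x hx y hy s t hs ht hst
    simp only [Set.mem_ofPred_eq] at hx hy ⊢
    rw [map_add, IsPos.apply_real_smul, IsPos.apply_real_smul, hx, hy, ← add_mul,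
      ← Complex.ofReal_add, hst, Complex.ofReal_one, one_mul]
  refine dixmierSet_subset hS (isClosed_eq τ.continuous continuous_const) (fun u => ?_) hz
  show τ _ = _
  rw [hτ.2.2, ← mul_assoc, Unitary.coe_star_mul_self, one_mul]

theorem DixmierProperty.weaklyCentral (h : DixmierProperty A) : WeaklyCentral A := by
  intro M₁ M₂ h₁ h₂ hZ
  by_contra hne
  have hle : ¬ M₂ ≤ M₁ := fun hle => hne (h₂.2.2 M₁ h₁.1 h₁.2.1 hle)
  obtain ⟨m, hm, x, hx, hmx⟩ := h₁.exists_add_eq_one h₂.isIdeal hle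
  obtain ⟨z, hz, hzc⟩ := h m
  have hz1 : z ∈ M₁ := dixmierSet_subset_ideal h₁.1 hm hz
  have hz2 : 1 - z ∈ M₂ := dixmierSet_subset_ideal h₂.1
    (by rwa [← hmx, add_sub_cancel_left]) (one_sub_mem_dixmierSet hz)
  have hz3 : 1 - z ∈ (M₁ : Set A) ∩ Set.center A :=
    hZ ▸ ⟨hz2, sub_mem_center one_mem_center hzc⟩
  exact h₁.one_notMem (by simpa using M₁.add_mem hz3.1 hz1)

theorem mem_glimmSet {M : Submodule ℂ A} {z : A} (hz : z ∈ M) (hc : z ∈ Set.center A) (y : A) :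
    z * y ∈ glimmSet M := subset_closure (Submodule.subset_span ⟨z, ⟨hz, hc⟩, y, rfl⟩)

theorem mem_glimmSet_self {M : Submodule ℂ A} {z : A} (hz : z ∈ M) (hc : z ∈ Set.center A) :
    z ∈ glimmSet M := by simpa using mem_glimmSet hz hc 1

theorem glimmSet_subset_of {M : Submodule ℂ A} {S : Submodule ℂ A} (hS : IsClosed (S : Set A))
    (h : ∀ z ∈ M, z ∈ Set.center A → ∀ y : A, z * y ∈ S) : glimmSet M ⊆ S := by
  refine closure_minimal (Submodule.span_le.mpr ?_) hS
  rintro _ ⟨z, ⟨hz, hc⟩, y, rfl⟩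
  exact h z hz hc y

theorem glimmSet_subset {M : Submodule ℂ A} (hM : IsMaximalClosedIdeal M) : glimmSet M ⊆ M :=
  glimmSet_subset_of hM.1.1 fun z hz _ y => (hM.isIdeal y z hz).2

theorem apply_eq_zero_of_glimmSet {M : Submodule ℂ A} {f : A →L[ℂ] ℂ}
    (h : ∀ z ∈ M, z ∈ Set.center A → ∀ y : A, f (z * y) = 0) : ∀ x ∈ glimmSet M, f x = 0 :=
  fun _ hx => glimmSet_subset_of (S := LinearMap.ker f.toLinearMap)
    (isClosed_singleton.preimage f.continuous) h hx

theorem DixmierProperty.glimm_trace_unique (h : DixmierProperty A) {M : Submodule ℂ A}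
    (hM : IsMaximalClosedIdeal M) {τ₁ τ₂ : A →L[ℂ] ℂ} (h₁ : IsTracialState τ₁)
    (h₂ : IsTracialState τ₂) (hg₁ : ∀ x ∈ glimmSet M, τ₁ x = 0)
    (hg₂ : ∀ x ∈ glimmSet M, τ₂ x = 0) : τ₁ = τ₂ := by
  let _ := CStarAlgebra.spectralOrder A
  have _ := CStarAlgebra.spectralOrderedRing A
  ext a
  obtain ⟨z, hz, hzc⟩ := h a
  obtain ⟨c, hc⟩ := hM.exists_sub_smul_mem hzc
  have hmem := mem_glimmSet_self hc (sub_mem_center hzc (smul_mem_center c one_mem_center))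
  have key : ∀ τ : A →L[ℂ] ℂ, IsTracialState τ → (∀ x ∈ glimmSet M, τ x = 0) → τ a = c := by
    intro τ hτ hg
    have := hg _ hmem
    rwa [map_sub, map_smul, hτ.map_one, smul_eq_mul, mul_one, sub_eq_zero,
      hτ.apply_dixmierSet hz] at this
  rw [key τ₁ h₁ hg₁, key τ₂ h₂ hg₂]

theorem DixmierProperty.glimm_trace_vanish (h : DixmierProperty A) {M : Submodule ℂ A}
    (hM : IsMaximalClosedIdeal M) {τ : A →L[ℂ] ℂ} (hτ : IsTracialState τ)
    (hg : ∀ x ∈ glimmSet M, τ x = 0) : ∀ x ∈ M, τ x = 0 := by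
  intro x hx
  obtain ⟨z, hz, hzc⟩ := h x
  rw [← hτ.apply_dixmierSet hz]
  exact hg _ (mem_glimmSet_self (dixmierSet_subset_ideal hM.1 hx hz) hzc)

end DixmierImpliesTraces

section WeakStar

instance weakDual_isScalarTower : IsScalarTower ℝ ℂ (WeakDual ℂ A) :=
  ⟨fun r c f => DFunLike.ext _ _ fun x => by
    change ((r • c) • f x) = r • (c • f x)
    exact smul_assoc r c (f x)⟩

instance weakDual_locallyConvexSpace : LocallyConvexSpace ℝ (WeakDual ℂ A) :=
  inferInstanceAs (LocallyConvexSpace ℝ (WeakBilin (topDualPairing ℂ A)))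

theorem weakDual_real_smul_apply (r : ℝ) (φ : WeakDual ℂ A) (x : A) : (r • φ) x = r * φ x := rfl

theorem weakDual_add_apply (φ ψ : WeakDual ℂ A) (x : A) : (φ + ψ) x = φ x + ψ x := rfl

theorem weakDual_combo_apply (s t : ℝ) (φ ψ : WeakDual ℂ A) (x : A) :
    (s • φ + t • ψ) x = s * φ x + t * ψ x := rfl

/-- The real part of evaluation at `x`, as a continuous real functional on the weak dual. -/
def reEval (x : A) : WeakDual ℂ A →L[ℝ] ℝ where
  toFun φ := (φ x).re
  map_add' φ ψ := by simp [weakDual_add_apply]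
  map_smul' r φ := by simp [weakDual_real_smul_apply]
  cont := Complex.continuous_re.comp (WeakDual.eval_continuous x)

@[simp] theorem reEval_apply (x : A) (φ : WeakDual ℂ A) : reEval x φ = (φ x).re := rfl

theorem exists_extremePoint_isMax {E : Type*} [AddCommGroup E] [Module ℝ E] [TopologicalSpace E]
    [T2Space E] [IsTopologicalAddGroup E] [ContinuousSMul ℝ E] [LocallyConvexSpace ℝ E]
    {K : Set E} (hK : IsCompact K) (hne : K.Nonempty) (l : E →L[ℝ] ℝ) :
    ∃ e ∈ K.extremePoints ℝ, ∀ x ∈ K, l x ≤ l e := by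
  obtain ⟨x, hx, hmax⟩ := hK.exists_isMaxOn hne l.continuous.continuousOn
  have hF : IsExposed ℝ K (l.toExposed K) := ContinuousLinearMap.toExposed.isExposed
  obtain ⟨e, he⟩ := (hF.isCompact hK).extremePoints_nonempty ⟨x, hx, fun y hy => hmax hy⟩
  exact ⟨e, hF.isExtreme.extremePoints_subset_extremePoints he, fun y hy => he.1.2 y hy⟩

/-- The states of `A`, inside the weak dual. -/
def stateSpace (A : Type*) [CStarAlgebra A] : Set (WeakDual ℂ A) :=
  {φ | IsPos (WeakDual.toStrongDual φ) ∧ φ 1 = 1}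

theorem convex_stateSpace : Convex ℝ (stateSpace A) := by
  intro φ hφ ψ hψ s t hs ht hst
  refine ⟨fun a => ?_, ?_⟩
  · have h1 := hφ.1 a
    have h2 := hψ.1 a
    rw [WeakDual.toStrongDual_apply] at h1 h2 ⊢
    rw [weakDual_combo_apply]
    exact add_nonneg (mul_nonneg (by exact_mod_cast hs) h1) (mul_nonneg (by exact_mod_cast ht) h2)
  · rw [weakDual_combo_apply, hφ.2, hψ.2, mul_one, mul_one]
    exact_mod_cast hst

theorem isClosed_stateSpace : IsClosed (stateSpace A) := by
  have : stateSpace A = (⋂ a : A, {φ | 0 ≤ φ (star a * a)}) ∩ {φ | φ 1 = 1} := by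
    ext φ; simp [stateSpace, IsPos]
  rw [this]
  exact (isClosed_iInter fun a => isClosed_le continuous_const (WeakDual.eval_continuous _)).inter
    (isClosed_eq (WeakDual.eval_continuous _) continuous_const)

theorem isCompact_stateSpace : IsCompact (stateSpace A) := by
  let _ := CStarAlgebra.spectralOrder A
  have _ := CStarAlgebra.spectralOrderedRing A
  refine (WeakDual.isCompact_closedBall (𝕜 := ℂ) (E := A) 0 1).of_isClosed_subset
    isClosed_stateSpace fun φ hφ => ?_
  have h1 := hφ.1.norm_eq
  have h2 := hφ.2
  rw [WeakDual.toStrongDual_apply, h2, Complex.one_re] at h1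
  simp [h1]

end WeakStar

section CentralIdeals

/-- The functional `x ↦ f (z * x)`. -/
def weight (f : A →L[ℂ] ℂ) (z : A) : A →L[ℂ] ℂ := f ∘L ContinuousLinearMap.mul ℂ A z

@[simp] theorem weight_apply (f : A →L[ℂ] ℂ) (z x : A) : weight f z x = f (z * x) := rfl

/-- The ideal generated by the central elements annihilated by `χ`. -/
def centralIdeal (χ : A →L[ℂ] ℂ) : Submodule ℂ A :=
  Submodule.span ℂ {x | ∃ z ∈ Set.center A, χ z = 0 ∧ ∃ y : A, x = z * y}

theorem isIdeal_centralIdeal (χ : A →L[ℂ] ℂ) : IsIdeal (centralIdeal χ) := by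
  refine isIdeal_span ?_
  rintro a _ ⟨z, hz, h0, y, rfl⟩
  refine ⟨⟨z, hz, h0, a * y, ?_⟩, ⟨z, hz, h0, y * a, mul_assoc _ _ _⟩⟩
  rw [← mul_assoc, ← mul_comm_of_mem_center hz, mul_assoc]

theorem apply_eq_zero_of_centralIdeal {χ g : A →L[ℂ] ℂ}
    (h : ∀ z ∈ Set.center A, ∀ x, g (z * x) = χ z * g x) {x : A} (hx : x ∈ centralIdeal χ) :
    g x = 0 := by
  have : centralIdeal χ ≤ LinearMap.ker g.toLinearMap := by
    refine Submodule.span_le.mpr ?_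
    rintro _ ⟨z, hz, h0, y, rfl⟩
    simpa [h0] using h z hz y
  exact this hx

theorem exists_maximal_centralIdeal {χ : A →L[ℂ] ℂ} (h1 : χ 1 = 1)
    (h : ∀ z ∈ Set.center A, ∀ x, χ (z * x) = χ z * χ x) :
    ∃ M : Submodule ℂ A, IsMaximalClosedIdeal M ∧ centralIdeal χ ≤ M :=
  (isIdeal_centralIdeal χ).exists_maximal fun hm => by
    simpa [h1] using apply_eq_zero_of_centralIdeal h hm

theorem IsMaximalClosedIdeal.mem_iff_of_centralIdeal {M : Submodule ℂ A}
    (hM : IsMaximalClosedIdeal M) {χ : A →L[ℂ] ℂ} (h1 : χ 1 = 1) (hle : centralIdeal χ ≤ M)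
    {z : A} (hz : z ∈ Set.center A) : z ∈ M ↔ χ z = 0 := by
  have hmem : ∀ w ∈ Set.center A, χ w = 0 → w ∈ M := fun w hw h0 =>
    hle (Submodule.subset_span ⟨w, hw, h0, 1, (mul_one w).symm⟩)
  refine ⟨fun hzM => ?_, hmem z hz⟩
  have h2 := hmem (z - χ z • 1) (sub_mem_center hz (smul_mem_center _ one_mem_center))
    (by simp [h1])
  have h3 := M.sub_mem hzM h2
  rw [sub_sub_cancel] at h3
  by_contra hne
  exact hM.one_notMem (by simpa [smul_smul, hne] using M.smul_mem (χ z)⁻¹ h3)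

variable [PartialOrder A] [StarOrderedRing A]

theorem IsPos.weight {f : A →L[ℂ] ℂ} (hf : IsPos f) {z : A} (hz : z ∈ Set.center A)
    (h0 : 0 ≤ z) : IsPos (weight f z) := fun a => by
  rw [weight_apply, ← mul_assoc, mul_comm_of_mem_center hz]
  exact hf.nonneg (star_left_conjugate_nonneg h0 a)

theorem mul_of_scaled {χ g : A →L[ℂ] ℂ} (h1 : χ 1 = 1)
    (h : ∀ z ∈ Set.center A, (1 / 3 : ℝ) • (1 : A) ≤ z → z ≤ (2 / 3 : ℝ) • (1 : A) →
      ∀ x, g (z * x) = χ z * g x) :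
    ∀ z ∈ Set.center A, ∀ x, g (z * x) = χ z * g x := by
  have hsa : ∀ z ∈ Set.center A, IsSelfAdjoint z → ∀ x, g (z * x) = χ z * g x := by
    intro z hz hs x
    set r : ℝ := (6 * (‖z‖ + 1))⁻¹ with hr
    have hpos : 0 < ‖z‖ + 1 := by positivity
    have hr0 : 0 < r := by positivity
    have hrz : r * ‖z‖ ≤ 1 / 6 := by
      rw [hr, inv_mul_le_iff₀ (by positivity)]; linarith
    have hup : r • z ≤ (1 / 6 : ℝ) • (1 : A) := by
      calc r • z ≤ r • (‖z‖ • (1 : A)) := smul_le_smul_of_nonneg_left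
            (by simpa [Algebra.algebraMap_eq_smul_one] using hs.le_algebraMap_norm_self) hr0.le
        _ = (r * ‖z‖) • (1 : A) := smul_smul _ _ _
        _ ≤ _ := smul_le_smul_of_nonneg_right hrz zero_le_one
    have hlo : -((1 / 6 : ℝ) • (1 : A)) ≤ r • z := by
      rw [neg_le, ← smul_neg]
      calc r • (-z) ≤ r • (‖z‖ • (1 : A)) := smul_le_smul_of_nonneg_left
            (by simpa [Algebra.algebraMap_eq_smul_one] using hs.neg.le_algebraMap_norm_self) hr0.le
        _ = (r * ‖z‖) • (1 : A) := smul_smul _ _ _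
        _ ≤ _ := smul_le_smul_of_nonneg_right hrz zero_le_one
    have key := h ((1 / 2 : ℝ) • (1 : A) + r • z)
      (add_mem_center (real_smul_mem_center _ one_mem_center) (real_smul_mem_center _ hz))
      (by
        have := add_le_add_right hlo ((1 / 2 : ℝ) • (1 : A))
        rwa [← neg_smul, ← add_smul, show (1 / 2 : ℝ) + -(1 / 6) = 1 / 3 by norm_num] at this)
      (by
        have := add_le_add_right hup ((1 / 2 : ℝ) • (1 : A))
        rwa [← add_smul, show (1 / 2 : ℝ) + 1 / 6 = 2 / 3 by norm_num] at this) x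
    simp only [add_mul, smul_mul_assoc, one_mul, map_add, IsPos.apply_real_smul, h1, mul_one]
      at key
    have hrc : (r : ℂ) ≠ 0 := by exact_mod_cast hr0.ne'
    exact mul_left_cancel₀ hrc (by linear_combination key)
  intro z hz x
  have e1 := hsa _ (realPart_mem_center hz) (realPart z).2 x
  have e2 := hsa _ (imaginaryPart_mem_center hz) (imaginaryPart z).2 x
  conv_lhs => rw [← realPart_add_I_smul_imaginaryPart z]
  conv_rhs => rw [← realPart_add_I_smul_imaginaryPart z]
  simp only [add_mul, smul_mul_assoc, map_add, map_smul, smul_eq_mul, e1, e2]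
  ring

theorem IsPos.apply_mul_eq_zero {f : A →L[ℂ] ℂ} (hf : IsPos f) {x : A}
    (h : f (star x * x) = 0) (y : A) : f (y * x) = 0 := by
  have hre : ∀ y : A, (f (y * x)).re = 0 := by
    intro y
    have key : ∀ r : ℝ, 0 ≤ (f (y * star y)).re + 2 * r * (f (y * x)).re := by
      intro r
      have h1 := (Complex.le_def.mp (hf (star y + r • x))).1
      have h2 : f (star x * star y) = star (f (y * x)) := by rw [← hf.apply_star, star_mul]
      simp only [star_add, star_star, star_smul, mul_add, add_mul, smul_mul_assoc, mul_smul_comm,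
        map_add, IsPos.apply_real_smul, h, h2, star_trivial, mul_zero, add_zero, Complex.add_re,
        Complex.re_ofReal_mul, Complex.zero_re, Complex.star_def, Complex.conj_re] at h1
      linarith
    by_contra hne
    have := key (-((f (y * star y)).re + 1) / (2 * (f (y * x)).re))
    field_simp at this
    linarith
  apply Complex.ext (hre y)
  have := hre (Complex.I • y)
  rw [smul_mul_assoc, map_smul] at this
  simpa using this

end CentralIdeals

section ExtremeTraces

/-- The quotients by Glimm ideals have at most one trace, which vanishes on the maximal ideal. -/
def GlimmTraceCondition (A : Type*) [CStarAlgebra A] : Prop :=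
  ∀ M : Submodule ℂ A, IsMaximalClosedIdeal M →
    (∀ τ₁ τ₂ : A →L[ℂ] ℂ, IsTracialState τ₁ → IsTracialState τ₂ →
      (∀ x ∈ glimmSet M, τ₁ x = 0) → (∀ x ∈ glimmSet M, τ₂ x = 0) → τ₁ = τ₂) ∧
    (∀ τ : A →L[ℂ] ℂ, IsTracialState τ → (∀ x ∈ glimmSet M, τ x = 0) → ∀ x ∈ M, τ x = 0)

/-- The simple quotients have at most one trace, and extreme traces factor through them. -/
def SimpleTraceCondition (A : Type*) [CStarAlgebra A] : Prop :=
  (∀ M : Submodule ℂ A, IsMaximalClosedIdeal M →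
    ∀ τ₁ τ₂ : A →L[ℂ] ℂ, IsTracialState τ₁ → IsTracialState τ₂ →
      (∀ x ∈ M, τ₁ x = 0) → (∀ x ∈ M, τ₂ x = 0) → τ₁ = τ₂) ∧
  (∀ τ : A →L[ℂ] ℂ, IsExtremeTracialState τ →
    ∃ M : Submodule ℂ A, IsMaximalClosedIdeal M ∧ ∀ x ∈ M, τ x = 0)

theorem DixmierProperty.glimmTraceCondition (h : DixmierProperty A) : GlimmTraceCondition A :=
  fun _ hM => ⟨fun _ _ h₁ h₂ hg₁ hg₂ => h.glimm_trace_unique hM h₁ h₂ hg₁ hg₂,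
    fun _ hτ hg => h.glimm_trace_vanish hM hτ hg⟩

theorem IsTracialState.isTracialState_weight [PartialOrder A] [StarOrderedRing A]
    {τ : A →L[ℂ] ℂ} (hτ : IsTracialState τ) {z : A} (hz : z ∈ Set.center A) (h0 : 0 ≤ z)
    (hpos : 0 < (τ z).re) : IsTracialState (((τ z).re⁻¹ : ℂ) • weight τ z) := by
  have him := hτ.isPos.im_eq_zero (IsSelfAdjoint.of_nonneg h0)
  have hval : τ z = ((τ z).re : ℂ) := Complex.ext rfl (by simpa using him)
  have hinv : (0 : ℂ) ≤ ((τ z).re⁻¹ : ℂ) := by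
    rw [← Complex.ofReal_inv]; exact_mod_cast (inv_pos.mpr hpos).le
  refine isTracialState_of_isPos (fun a => ?_) ?_ fun a b => ?_
  · exact mul_nonneg hinv (hτ.isPos.weight hz h0 a)
  · change ((τ z).re⁻¹ : ℂ) * τ (z * 1) = 1
    rw [mul_one]
    nth_rw 2 [hval]
    exact inv_mul_cancel₀ (by exact_mod_cast hpos.ne')
  · change ((τ z).re⁻¹ : ℂ) * τ (z * (a * b)) = ((τ z).re⁻¹ : ℂ) * τ (z * (b * a))
    rw [← mul_assoc, hτ.2.2, ← mul_assoc, ← mul_assoc, ← mul_comm_of_mem_center hz b]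

theorem IsExtremeTracialState.apply_center_mul {τ : A →L[ℂ] ℂ} (hτ : IsExtremeTracialState τ) :
    ∀ z ∈ Set.center A, ∀ x, τ (z * x) = τ z * τ x := by
  let _ := CStarAlgebra.spectralOrder A
  have _ := CStarAlgebra.spectralOrderedRing A
  have h1 := hτ.1.map_one
  refine mul_of_scaled h1 fun z hz hlo hup x => ?_
  have hlo' := hτ.1.isPos.re_mono hlo
  have hup' := hτ.1.isPos.re_mono hup
  simp only [IsPos.apply_real_smul, h1, mul_one, Complex.ofReal_re] at hlo' hup'
  have h0 : 0 ≤ z := le_trans (smul_nonneg (by norm_num) zero_le_one) hlo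
  have h0' : 0 ≤ 1 - z := sub_nonneg.mpr (hup.trans (by
    conv_rhs => rw [← one_smul ℝ (1 : A)]
    exact smul_le_smul_of_nonneg_right (by norm_num) zero_le_one))
  have hz' := sub_mem_center one_mem_center hz
  have hval : τ z = ((τ z).re : ℂ) :=
    Complex.ext rfl (by simpa using hτ.1.isPos.im_eq_zero (IsSelfAdjoint.of_nonneg h0))
  have hre' : (τ (1 - z)).re = 1 - (τ z).re := by rw [map_sub, h1]; simp
  have hne : ((τ z).re : ℂ) ≠ 0 := by norm_cast; linarith
  have hne' : (1 - (τ z).re : ℂ) ≠ 0 := by norm_cast; linarith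
  have := (hτ.2 _ _ (hτ.1.isTracialState_weight hz h0 (by linarith))
    (hτ.1.isTracialState_weight hz' h0' (by linarith)) (τ z).re (by linarith) (by linarith)
    fun a => by
      rw [hre']
      simp only [_root_.smul_apply, weight_apply, smul_eq_mul, sub_mul, one_mul, map_sub]
      push_cast
      field_simp
      ring).1
  have h2 := DFunLike.congr_fun this x
  change ((τ z).re⁻¹ : ℂ) * τ (z * x) = τ x at h2
  rw [← h2, hval, Complex.ofReal_re, mul_inv_cancel_left₀ hne]

theorem GlimmTraceCondition.simpleTraceCondition (h : GlimmTraceCondition A) :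
    SimpleTraceCondition A := by
  let _ := CStarAlgebra.spectralOrder A
  have _ := CStarAlgebra.spectralOrderedRing A
  refine ⟨fun M hM τ₁ τ₂ h₁ h₂ hv₁ hv₂ => (h M hM).1 τ₁ τ₂ h₁ h₂
    (fun x hx => hv₁ x (glimmSet_subset hM hx)) fun x hx => hv₂ x (glimmSet_subset hM hx),
    fun τ hτ => ?_⟩
  have hmul := hτ.apply_center_mul
  obtain ⟨M, hM, hle⟩ := exists_maximal_centralIdeal hτ.1.map_one hmul
  refine ⟨M, hM, (h M hM).2 τ hτ.1 (apply_eq_zero_of_glimmSet fun z hzM hz y => ?_)⟩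
  rw [hmul z hz, (hM.mem_iff_of_centralIdeal hτ.1.map_one hle hz).mp hzM, zero_mul]

/-- The tracial states vanishing on the Glimm ideal of `M`, inside the weak dual. -/
def glimmTraces (M : Submodule ℂ A) : Set (WeakDual ℂ A) :=
  {φ | φ ∈ stateSpace A ∧ (∀ a b, φ (a * b) = φ (b * a)) ∧
    ∀ z ∈ M, z ∈ Set.center A → ∀ y, φ (z * y) = 0}

theorem isCompact_glimmTraces (M : Submodule ℂ A) : IsCompact (glimmTraces M) := by
  have : glimmTraces M = stateSpace A ∩ ((⋂ a : A, ⋂ b : A, {φ | φ (a * b) = φ (b * a)}) ∩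
      ⋂ z ∈ M, ⋂ _ : z ∈ Set.center A, ⋂ y, {φ | φ (z * y) = 0}) := by
    ext φ; simp [glimmTraces]; tauto
  rw [this]
  refine isCompact_stateSpace.inter_right (.inter ?_ ?_)
  · exact isClosed_iInter fun a => isClosed_iInter fun b =>
      isClosed_eq (WeakDual.eval_continuous _) (WeakDual.eval_continuous _)
  · exact isClosed_iInter fun z => isClosed_iInter fun _ => isClosed_iInter fun _ =>
      isClosed_iInter fun y => isClosed_eq (WeakDual.eval_continuous _) continuous_const

theorem isTracialState_of_mem_glimmTraces {M : Submodule ℂ A} {φ : WeakDual ℂ A}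
    (h : φ ∈ glimmTraces M) : IsTracialState (WeakDual.toStrongDual φ) := by
  let _ := CStarAlgebra.spectralOrder A
  have _ := CStarAlgebra.spectralOrderedRing A
  exact isTracialState_of_isPos h.1.1 h.1.2 h.2.1

theorem mem_glimmTraces {M : Submodule ℂ A} {τ : A →L[ℂ] ℂ} (h : IsTracialState τ)
    (hv : ∀ z ∈ M, z ∈ Set.center A → ∀ y, τ (z * y) = 0) :
    StrongDual.toWeakDual τ ∈ glimmTraces M := by
  let _ := CStarAlgebra.spectralOrder A
  have _ := CStarAlgebra.spectralOrderedRing A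
  exact ⟨⟨h.isPos, h.map_one⟩, h.2.2, hv⟩

theorem isExtremeTracialState_of_mem_extremePoints {M : Submodule ℂ A} {e : WeakDual ℂ A}
    (he : e ∈ (glimmTraces M).extremePoints ℝ) :
    IsExtremeTracialState (WeakDual.toStrongDual e) := by
  let _ := CStarAlgebra.spectralOrder A
  have _ := CStarAlgebra.spectralOrderedRing A
  refine ⟨isTracialState_of_mem_glimmTraces he.1, fun τ₁ τ₂ h₁ h₂ t ht0 ht1 hcomb => ?_⟩
  have hv : ∀ z ∈ M, z ∈ Set.center A → ∀ y, τ₁ (z * y) = 0 ∧ τ₂ (z * y) = 0 := by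
    intro z hz hc y
    have h0 : e (z * star z) = 0 := he.1.2.2 z hz hc (star z)
    rw [mul_comm_of_mem_center hc] at h0
    have hre := congrArg Complex.re (hcomb (star z * z))
    rw [WeakDual.toStrongDual_apply, h0, ← Complex.ofReal_one, ← Complex.ofReal_sub,
      Complex.add_re, Complex.re_ofReal_mul, Complex.re_ofReal_mul, Complex.zero_re] at hre
    have p1 := (Complex.le_def.mp (h₁.isPos z)).1
    have p2 := (Complex.le_def.mp (h₂.isPos z)).1
    rw [Complex.zero_re] at p1 p2
    have q1 : (τ₁ (star z * z)).re = 0 := by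
      nlinarith [mul_nonneg ht0.le p1, mul_nonneg (sub_nonneg.mpr ht1.le) p2]
    have q2 : (τ₂ (star z * z)).re = 0 := by
      nlinarith [mul_nonneg ht0.le p1, mul_nonneg (sub_nonneg.mpr ht1.le) p2]
    rw [mul_comm_of_mem_center hc]
    exact ⟨h₁.isPos.apply_mul_eq_zero
        (Complex.ext q1 (h₁.isPos.im_eq_zero (IsSelfAdjoint.star_mul_self z))) y,
      h₂.isPos.apply_mul_eq_zero
        (Complex.ext q2 (h₂.isPos.im_eq_zero (IsSelfAdjoint.star_mul_self z))) y⟩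
  have hseg : e ∈ openSegment ℝ (StrongDual.toWeakDual τ₁) (StrongDual.toWeakDual τ₂) := by
    refine ⟨t, 1 - t, ht0, sub_pos.mpr ht1, by ring, DFunLike.ext _ _ fun a => ?_⟩
    rw [weakDual_combo_apply]
    exact_mod_cast (hcomb a).symm
  have := mem_extremePoints_iff_left.mp he
  have e1 := this.2 _ (mem_glimmTraces h₁ fun z hz hc y => (hv z hz hc y).1) _
    (mem_glimmTraces h₂ fun z hz hc y => (hv z hz hc y).2) hseg
  have e2 := this.2 _ (mem_glimmTraces h₂ fun z hz hc y => (hv z hz hc y).2) _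
    (mem_glimmTraces h₁ fun z hz hc y => (hv z hz hc y).1) (by rwa [openSegment_symm])
  exact ⟨congrArg WeakDual.toStrongDual e1, congrArg WeakDual.toStrongDual e2⟩

theorem SimpleTraceCondition.apply_extremePoint (h : SimpleTraceCondition A)
    (hw : WeaklyCentral A) {M : Submodule ℂ A} (hM : IsMaximalClosedIdeal M) {e : WeakDual ℂ A}
    (he : e ∈ (glimmTraces M).extremePoints ℝ) : ∀ x ∈ M, e x = 0 := by
  obtain ⟨M', hM', hv⟩ := h.2 _ (isExtremeTracialState_of_mem_extremePoints he)
  have hz0 : ∀ z ∈ M, z ∈ Set.center A → e z = 0 := fun z hz hc => by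
    simpa using he.1.2.2 z hz hc 1
  have key : ∀ (N N' : Submodule ℂ A), IsMaximalClosedIdeal N →
      (∀ z ∈ N, z ∈ Set.center A → e z = 0) → (∀ z ∈ N', z ∈ Set.center A → e z = 0) →
      (N' : Set A) ∩ Set.center A ⊆ (N : Set A) ∩ Set.center A := by
    intro N N' hN h1 h2 z hz
    obtain ⟨c, hc⟩ := hN.exists_sub_smul_mem hz.2
    have h3 := h1 _ hc (sub_mem_center hz.2 (smul_mem_center c one_mem_center))
    rw [map_sub, map_smul, h2 z hz.1 hz.2, he.1.1.2] at h3
    have hc0 : c = 0 := by simpa using h3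
    rw [hc0, zero_smul, sub_zero] at hc
    exact ⟨hc, hz.2⟩
  have hv' : ∀ z ∈ M', z ∈ Set.center A → e z = 0 := fun z hz _ => hv z hz
  have hMM' : M' = M := hw M' M hM' hM
    (subset_antisymm (key M M' hM hz0 hv') (key M' M hM' hv' hz0))
  exact fun x hx => hv x (hMM' ▸ hx)

theorem SimpleTraceCondition.glimmTraceCondition (h : SimpleTraceCondition A)
    (hw : WeaklyCentral A) : GlimmTraceCondition A := by
  intro M hM
  have hmem : ∀ τ : A →L[ℂ] ℂ, IsTracialState τ → (∀ x ∈ glimmSet M, τ x = 0) →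
      StrongDual.toWeakDual τ ∈ glimmTraces M := fun τ hτ hg =>
    mem_glimmTraces hτ fun z hz hc y => hg _ (mem_glimmSet hz hc y)
  have hunique : ∀ e ∈ (glimmTraces M).extremePoints ℝ, ∀ e' ∈ (glimmTraces M).extremePoints ℝ,
      e = e' := fun e he e' he' => by
    have := h.1 M hM _ _ (isTracialState_of_mem_glimmTraces he.1)
      (isTracialState_of_mem_glimmTraces he'.1) (h.apply_extremePoint hw hM he)
      (h.apply_extremePoint hw hM he')
    exact WeakDual.toStrongDual.injective this
  have hle : ∀ φ ∈ glimmTraces M, ∀ e ∈ (glimmTraces M).extremePoints ℝ, ∀ x,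
      (φ x).re ≤ (e x).re := fun φ hφ e he x => by
    obtain ⟨e', he', hmax⟩ := exists_extremePoint_isMax (isCompact_glimmTraces M) ⟨φ, hφ⟩
      (reEval x)
    rw [hunique e he e' he']
    exact hmax φ hφ
  have heq : ∀ φ ∈ glimmTraces M, ∀ e ∈ (glimmTraces M).extremePoints ℝ, φ = e := by
    intro φ hφ e he
    refine WeakDual.toStrongDual.injective (IsPos.ext_re fun x => le_antisymm (hle φ hφ e he x) ?_)
    have := hle φ hφ e he (-x)
    rw [map_neg, map_neg, Complex.neg_re, Complex.neg_re] at this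
    exact neg_le_neg_iff.mp this
  refine ⟨fun τ₁ τ₂ h₁ h₂ hg₁ hg₂ => ?_, fun τ hτ hg x hx => ?_⟩
  · obtain ⟨e, he⟩ := (isCompact_glimmTraces M).extremePoints_nonempty ⟨_, hmem τ₁ h₁ hg₁⟩
    exact StrongDual.toWeakDual.injective
      ((heq _ (hmem τ₁ h₁ hg₁) e he).trans (heq _ (hmem τ₂ h₂ hg₂) e he).symm)
  · obtain ⟨e, he⟩ := (isCompact_glimmTraces M).extremePoints_nonempty ⟨_, hmem τ hτ hg⟩
    have h2 := h.apply_extremePoint hw hM he x hx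
    rw [← heq _ (hmem τ hτ hg) e he] at h2
    exact h2

end ExtremeTraces

section QuotientOrder

/-- `x ≤ y` modulo the ideal `J`, tested on the positive functionals vanishing on `J`. -/
def QLE (J : Submodule ℂ A) (x y : A) : Prop :=
  ∀ f : A →L[ℂ] ℂ, IsPos f → (∀ z ∈ J, f z = 0) → (f x).re ≤ (f y).re

namespace QLE

variable {J : Submodule ℂ A} {x y z w : A}

theorem refl (x : A) : QLE J x x := fun _ _ _ => le_rfl

theorem trans (h : QLE J x y) (h' : QLE J y z) : QLE J x z :=
  fun f hf hJ => (h f hf hJ).trans (h' f hf hJ)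

theorem add (h : QLE J x y) (h' : QLE J z w) : QLE J (x + z) (y + w) := fun f hf hJ => by
  simpa using add_le_add (h f hf hJ) (h' f hf hJ)

theorem smul (h : QLE J x y) {r : ℝ} (hr : 0 ≤ r) : QLE J (r • x) (r • y) := fun f hf hJ => by
  rw [IsPos.apply_real_smul, IsPos.apply_real_smul, Complex.re_ofReal_mul, Complex.re_ofReal_mul]
  exact mul_le_mul_of_nonneg_left (h f hf hJ) hr

theorem sum {ι : Type*} (s : Finset ι) {x y : ι → A} (h : ∀ i ∈ s, QLE J (x i) (y i)) :
    QLE J (∑ i ∈ s, x i) (∑ i ∈ s, y i) := fun f hf hJ => by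
  simpa using Finset.sum_le_sum fun i hi => h i hi f hf hJ

theorem conj (hJ : IsIdeal J) (h : QLE J x y) (w : A) :
    QLE J (star w * x * w) (star w * y * w) := fun f hf h0 => by
  simpa using h (IsPos.conj f w) (IsPos.isPos_conj hf w) fun z hz => by
    rw [IsPos.conj_apply]
    exact h0 _ (hJ _ _ (hJ _ _ hz).1).2

variable [PartialOrder A] [StarOrderedRing A]

theorem of_le (h : x ≤ y) : QLE J x y := fun _ hf _ => hf.re_mono h

theorem star_mul_self_le_one (hJ : IsIdeal J) (h : QLE J (x * star x) 1) :
    QLE J (star x * x) 1 := fun f hf h0 => by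
  have h1 := h.conj hJ x f hf h0
  have h2 := hf.re_nonneg (star_mul_self_nonneg (star x * x - 1))
  simp only [star_sub, star_mul, star_star, star_one, mul_sub, sub_mul, mul_one, one_mul, map_sub,
    Complex.sub_re, mul_assoc] at h1 h2
  linarith

end QLE

end QuotientOrder

section CuntzPedersen

variable {J : Submodule ℂ A} {S T : Set A} {c c' d d' e : A}

/-- Approximate Cuntz–Pedersen subequivalence modulo `J`, implemented by elements of `S`. -/
def CPRel (J : Submodule ℂ A) (S : Set A) (c d : A) : Prop :=
  ∀ ε : ℝ, 0 < ε → ∃ (ι : Type) (_ : Fintype ι) (x : ι → A), (∀ i, x i ∈ S) ∧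
    QLE J (c - ε • (1 : A)) (∑ i, star (x i) * x i) ∧ QLE J (∑ i, x i * star (x i)) d

namespace CPRel

theorem mono_left (h : QLE J c c') (hr : CPRel J S c' d) : CPRel J S c d := fun ε hε => by
  obtain ⟨ι, _, x, hx, h1, h2⟩ := hr ε hε
  refine ⟨ι, _, x, hx, QLE.trans ?_ h1, h2⟩
  simpa [sub_eq_add_neg] using h.add (QLE.refl (-(ε • (1 : A))))

theorem mono_right (hr : CPRel J S c d) (h : QLE J d d') : CPRel J S c d' := fun ε hε => by
  obtain ⟨ι, _, x, hx, h1, h2⟩ := hr ε hε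
  exact ⟨ι, _, x, hx, h1, h2.trans h⟩

theorem add (h : CPRel J Set.univ c d) (h' : CPRel J Set.univ c' d') :
    CPRel J Set.univ (c + c') (d + d') := fun ε hε => by
  obtain ⟨ι, _, x, -, h1, h2⟩ := h (ε / 2) (half_pos hε)
  obtain ⟨ι', _, x', -, h1', h2'⟩ := h' (ε / 2) (half_pos hε)
  refine ⟨ι ⊕ ι', inferInstance, Sum.elim x x', fun _ => trivial, ?_, ?_⟩
  · have : c + c' - ε • (1 : A) = (c - (ε / 2) • (1 : A)) + (c' - (ε / 2) • (1 : A)) := by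
      rw [sub_add_sub_comm, ← add_smul, add_halves]
    rw [this]
    simpa using h1.add h1'
  · simpa using h2.add h2'

theorem mono_set (h : CPRel J S c d) (hST : S ⊆ T) : CPRel J T c d := fun ε hε => by
  obtain ⟨ι, _, x, hx, h1, h2⟩ := h ε hε
  exact ⟨ι, _, x, fun i => hST (hx i), h1, h2⟩

theorem of_smul {k : ℝ} (hk : 0 < k) (h : CPRel J Set.univ (k • c) (k • d)) :
    CPRel J Set.univ c d := fun ε hε => by
  obtain ⟨ι, _, x, -, h1, h2⟩ := h (k * ε) (mul_pos hk hε)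
  have hs : (√k)⁻¹ * (√k)⁻¹ = k⁻¹ := by rw [← mul_inv, Real.mul_self_sqrt hk.le]
  have hk' : k⁻¹ * k = 1 := inv_mul_cancel₀ hk.ne'
  refine ⟨ι, inferInstance, fun i => (√k)⁻¹ • x i, fun _ => trivial, ?_, ?_⟩
  · have := h1.smul (inv_pos.mpr hk).le
    simpa [smul_sub, smul_smul, Finset.smul_sum, hs, hk', ← mul_assoc] using this
  · have := h2.smul (inv_pos.mpr hk).le
    simpa [smul_sub, smul_smul, Finset.smul_sum, hs, hk', ← mul_assoc] using this

variable [PartialOrder A] [StarOrderedRing A]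

theorem of_eq {ι : Type} [Fintype ι] {x : ι → A} (hx : ∀ i, x i ∈ S)
    (h1 : QLE J c (∑ i, star (x i) * x i)) (h2 : QLE J (∑ i, x i * star (x i)) d) :
    CPRel J S c d := fun _ hε =>
  ⟨ι, _, x, hx, (QLE.of_le (sub_le_self _ (smul_nonneg hε.le zero_le_one))).trans h1, h2⟩

theorem refl_mul_self {γ : A} (hγ : IsSelfAdjoint γ) : CPRel J {γ} (γ * γ) (γ * γ) :=
  of_eq (ι := Unit) (x := fun _ => γ) (fun _ => rfl) (by simpa [hγ.star_eq] using QLE.refl _)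
    (by simpa [hγ.star_eq] using QLE.refl _)

theorem refl (hc : 0 ≤ c) : CPRel J Set.univ c c := by
  have h := refl_mul_self (J := J) (IsSelfAdjoint.of_nonneg (CFC.sqrt_nonneg c))
  rw [CFC.sqrt_mul_sqrt_self c] at h
  exact h.mono_set (Set.subset_univ _)

theorem exists_inv_sqrt {b : A} (hb : 0 ≤ b) {ε : ℝ} (hε : 0 < ε) :
    ∃ r : A, IsSelfAdjoint r ∧ r * b * r = 1 - ε • (r * r) := by
  have hsa : IsSelfAdjoint b := IsSelfAdjoint.of_nonneg hb
  have hsp : ∀ s ∈ spectrum ℝ b, 0 < s + ε := fun s hs => by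
    linarith [spectrum_nonneg_of_nonneg hb hs]
  have hcont : ContinuousOn (fun s : ℝ => (√(s + ε))⁻¹) (spectrum ℝ b) :=
    ContinuousOn.inv₀ (by fun_prop) fun s hs => (Real.sqrt_pos.mpr (hsp s hs)).ne'
  refine ⟨cfc (fun s : ℝ => (√(s + ε))⁻¹) b, IsSelfAdjoint.cfc, ?_⟩
  rw [eq_sub_iff_add_eq]
  conv_lhs => enter [1, 1, 2]; rw [← cfc_id' ℝ b]
  rw [← cfc_mul _ _ b, ← cfc_mul _ _ b, ← cfc_mul _ _ b, ← cfc_smul _ _ b, ← cfc_add b _ _,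
    ← cfc_one ℝ b]
  refine cfc_congr fun s hs => ?_
  have h1 := Real.mul_self_sqrt (hsp s hs).le
  have h2 := (Real.sqrt_pos.mpr (hsp s hs)).ne'
  simp only [smul_eq_mul, Pi.one_apply]
  field_simp
  nlinarith

theorem trans (hJ : IsIdeal J) (h : CPRel J S c d) (h' : CPRel J T d e) :
    CPRel J {w | ∃ y ∈ T, ∃ r : A, ∃ x ∈ S, w = y * r * x} c e := fun ε hε => by
  obtain ⟨ι, _, x, hx, h1, h2⟩ := h (ε / 2) (half_pos hε)
  set n : ℝ := ((Fintype.card ι : ℕ) : ℝ) with hn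
  have hn0 : 0 ≤ n := Nat.cast_nonneg _
  set η : ℝ := ε / 2 / (n + 1) with hη
  have hη0 : 0 < η := by positivity
  have hηn : η * n ≤ ε / 2 := by
    rw [hη, div_mul_eq_mul_div, div_le_iff₀ (by positivity)]
    nlinarith
  obtain ⟨κ, _, y, hy, h3, h4⟩ := h' η hη0
  set b : A := ∑ j, star (y j) * y j with hb
  have hb0 : 0 ≤ b := Finset.sum_nonneg fun j _ => star_mul_self_nonneg _
  obtain ⟨r, hr, hrb⟩ := exists_inv_sqrt hb0 hη0
  have hd : QLE J (∑ i, x i * star (x i)) (b + η • (1 : A)) := by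
    refine h2.trans ?_
    simpa using h3.add (QLE.refl (η • (1 : A)))
  have hrd : QLE J (r * (∑ i, x i * star (x i)) * r) 1 := by
    have := hd.conj hJ r
    rwa [hr.star_eq, mul_add, add_mul, hrb, mul_smul_comm, smul_mul_assoc, mul_one,
      sub_add_cancel] at this
  refine ⟨ι × κ, inferInstance, fun p => y p.2 * r * x p.1,
    fun p => ⟨_, hy _, r, _, hx _, rfl⟩, ?_, ?_⟩
  · have hone : ∀ i, QLE J (star (x i) * (r * r) * x i) 1 := fun i => by
      have : QLE J (r * x i * star (r * x i)) 1 := by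
        refine QLE.trans (QLE.of_le ?_) hrd
        have hle : x i * star (x i) ≤ ∑ i, x i * star (x i) :=
          Finset.single_le_sum (f := fun i => x i * star (x i))
            (fun j _ => mul_star_self_nonneg _) (Finset.mem_univ i)
        simpa [hr.star_eq, mul_assoc] using star_left_conjugate_le_conjugate hle r
      simpa [hr.star_eq, mul_assoc] using this.star_mul_self_le_one hJ
    have hsum : ∑ p : ι × κ, star (y p.2 * r * x p.1) * (y p.2 * r * x p.1)
        = ∑ i, star (x i) * x i + (-η) • ∑ i, star (x i) * (r * r) * x i := by
      rw [Fintype.sum_prod_type, Finset.smul_sum, ← Finset.sum_add_distrib]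
      refine Finset.sum_congr rfl fun i _ => ?_
      have : ∑ j, star (y j * r * x i) * (y j * r * x i) = star (x i) * (r * b * r) * x i := by
        rw [hb, Finset.mul_sum, Finset.sum_mul, Finset.mul_sum, Finset.sum_mul]
        refine Finset.sum_congr rfl fun j _ => ?_
        simp [hr.star_eq, mul_assoc]
      rw [this, hrb, mul_sub, sub_mul, mul_one, mul_smul_comm, smul_mul_assoc, neg_smul,
        sub_eq_add_neg]
    intro f hf h0
    have e1 := h1 f hf h0
    have e2 := QLE.sum Finset.univ (fun i _ => hone i) f hf h0
    rw [hsum, map_add, IsPos.apply_real_smul, Complex.add_re, Complex.re_ofReal_mul]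
    rw [map_sub, IsPos.apply_real_smul, Complex.sub_re, Complex.re_ofReal_mul] at e1 ⊢
    rw [Finset.sum_const, Finset.card_univ, map_nsmul, nsmul_eq_mul, ← Complex.ofReal_natCast,
      Complex.re_ofReal_mul, ← hn] at e2
    have hf1 := hf.one_nonneg
    nlinarith [mul_le_mul_of_nonneg_left e2 hη0.le, mul_le_mul_of_nonneg_right hηn hf1]
  · have hsum : ∑ p : ι × κ, (y p.2 * r * x p.1) * star (y p.2 * r * x p.1)
        = ∑ j, y j * (r * (∑ i, x i * star (x i)) * r) * star (y j) := by
      rw [Fintype.sum_prod_type_right]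
      refine Finset.sum_congr rfl fun j _ => ?_
      rw [Finset.mul_sum, Finset.sum_mul, Finset.mul_sum, Finset.sum_mul]
      refine Finset.sum_congr rfl fun i _ => ?_
      simp [hr.star_eq, mul_assoc]
    rw [hsum]
    refine (QLE.sum Finset.univ fun j _ => ?_).trans h4
    simpa using hrd.conj hJ (star (y j))

end CPRel

end CuntzPedersen

section Comparison

variable {J : Submodule ℂ A} {b c d s w w' : A}

/-- Finite sums of self-commutators `star x * x - x * star x`. -/
def IsCommSum (w : A) : Prop :=
  ∃ (ι : Type) (_ : Fintype ι) (x : ι → A), w = ∑ i, (star (x i) * x i - x i * star (x i))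

namespace IsCommSum

theorem zero : IsCommSum (0 : A) := ⟨Empty, inferInstance, fun i => i.elim, by simp⟩

theorem single (x : A) : IsCommSum (star x * x - x * star x) :=
  ⟨Unit, inferInstance, fun _ => x, by simp⟩

theorem add (h : IsCommSum w) (h' : IsCommSum w') : IsCommSum (w + w') := by
  obtain ⟨ι, _, x, rfl⟩ := h
  obtain ⟨ι', _, x', rfl⟩ := h'
  exact ⟨ι ⊕ ι', inferInstance, Sum.elim x x', by simp; abel⟩

theorem smul (h : IsCommSum w) {r : ℝ} (hr : 0 ≤ r) : IsCommSum (r • w) := by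
  obtain ⟨ι, _, x, rfl⟩ := h
  refine ⟨ι, inferInstance, fun i => √r • x i, ?_⟩
  rw [Finset.smul_sum]
  refine Finset.sum_congr rfl fun i _ => ?_
  simp only [star_smul, star_trivial, smul_mul_smul_comm, Real.mul_self_sqrt hr, smul_sub]

end IsCommSum

/-- Elements lying strictly below a sum of self-commutators modulo `J`. -/
def strictlyBelowComm (J : Submodule ℂ A) : Set A :=
  {e | ∃ η : ℝ, 0 < η ∧ ∃ w, IsCommSum w ∧ QLE J e (-(η • (1 : A)) + w)}

theorem smul_sub_mem_strictlyBelowComm (hw : IsCommSum w) (h : QLE J b w) {t η : ℝ} (ht : 0 ≤ t)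
    (hη : 0 < η) : t • b - η • (1 : A) ∈ strictlyBelowComm J := by
  refine ⟨η, hη, t • w, hw.smul ht, ?_⟩
  have := (h.smul ht).add (QLE.refl (-(η • (1 : A))))
  rwa [← sub_eq_add_neg, add_comm (t • w)] at this

theorem convex_strictlyBelowComm : Convex ℝ (strictlyBelowComm J) := by
  rintro x ⟨η, hη, w, hw, h⟩ y ⟨η', hη', w', hw', h'⟩ a b ha hb hab
  refine ⟨a * η + b * η', ?_, a • w + b • w', (hw.smul ha).add (hw'.smul hb), ?_⟩
  · rcases ha.eq_or_lt with rfl | ha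
    · have : b = 1 := by simpa using hab
      simpa [this] using hη'
    · exact add_pos_of_pos_of_nonneg (mul_pos ha hη) (mul_nonneg hb hη'.le)
  · have := (h.smul ha).add (h'.smul hb)
    convert this using 1
    module

theorem QLE.sub_smul_one_of_norm_le {x y : A} {r : ℝ} (h : ‖x - y‖ ≤ r) :
    QLE J x (y + r • (1 : A)) := fun f hf _ => by
  let _ := CStarAlgebra.spectralOrder A
  have _ := CStarAlgebra.spectralOrderedRing A
  have h1 := hf.re_le_norm (x - y)
  have h2 := mul_le_mul_of_nonneg_right h hf.one_nonneg
  rw [map_sub, Complex.sub_re] at h1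
  rw [map_add, IsPos.apply_real_smul, Complex.add_re, Complex.re_ofReal_mul]
  linarith

theorem isOpen_strictlyBelowComm : IsOpen (strictlyBelowComm J) := by
  rw [Metric.isOpen_iff]
  rintro x ⟨η, hη, w, hw, h⟩
  refine ⟨η / 2, half_pos hη, fun y hy => ⟨η / 2, half_pos hη, w, hw, ?_⟩⟩
  have h1 : QLE J y (x + (η / 2) • (1 : A)) :=
    QLE.sub_smul_one_of_norm_le (by simpa [dist_eq_norm] using (Metric.mem_ball.mp hy).le)
  refine h1.trans ?_
  convert h.add (QLE.refl ((η / 2) • (1 : A))) using 1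
  module

/-- Positive traces vanishing on `J` detect the order up to sums of self-commutators. -/
theorem exists_isCommSum
    (h : ∀ τ : A →L[ℂ] ℂ, IsPos τ → (∀ a b, τ (a * b) = τ (b * a)) → (∀ z ∈ J, τ z = 0) →
      (τ c).re ≤ (τ d).re) {δ : ℝ} (hδ : 0 < δ) :
    ∃ w, IsCommSum w ∧ QLE J c (d + δ • (1 : A) + w) := by
  let _ := CStarAlgebra.spectralOrder A
  have _ := CStarAlgebra.spectralOrderedRing A
  set p : A := c - d - δ • (1 : A) with hp
  by_cases hps : p ∈ strictlyBelowComm J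
  · obtain ⟨η, hη, w, hw, hq⟩ := hps
    refine ⟨w, hw, fun f hf h0 => ?_⟩
    have := hq f hf h0
    simp only [hp, map_add, map_sub, map_neg, IsPos.apply_real_smul, Complex.add_re,
      Complex.sub_re, Complex.neg_re, Complex.re_ofReal_mul] at this ⊢
    nlinarith [mul_nonneg hη.le hf.one_nonneg]
  exfalso
  obtain ⟨F, hF⟩ := RCLike.geometric_hahn_banach_open_point (𝕜 := ℂ) convex_strictlyBelowComm
    isOpen_strictlyBelowComm hps
  replace hF : ∀ e ∈ strictlyBelowComm J, (F e).re < (F p).re := hF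
  have key : ∀ e w : A, IsCommSum w → QLE J e w → (F e).re ≤ 0 := fun e w hw he => by
    by_contra! hlt
    obtain ⟨t, ht⟩ := exists_nat_gt (((F p).re + (F 1).re) / (F e).re)
    have := hF _ (smul_sub_mem_strictlyBelowComm hw he (Nat.cast_nonneg t) one_pos)
    rw [div_lt_iff₀ hlt] at ht
    simp only [map_sub, IsPos.apply_real_smul, Complex.sub_re, Complex.re_ofReal_mul] at this
    linarith
  have hpos : IsPos F := by
    refine IsPos.of_re (fun x hx => ?_) fun x hx => ?_
    · have := key (-x) 0 .zero fun f hf _ => by simpa using hf.re_nonneg hx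
      simpa using this
    · have h1 := key (Complex.I • x) 0 .zero fun f hf _ => by simp [hf.im_eq_zero hx]
      have h2 := key (-(Complex.I • x)) 0 .zero fun f hf _ => by simp [hf.im_eq_zero hx]
      rw [map_neg, Complex.neg_re] at h2
      linarith
  have hJ0 : ∀ z ∈ J, (F z).re = 0 := fun z hz => by
    have h1 := key z 0 .zero fun f _ h0 => by simp [h0 z hz]
    have h2 := key (-z) 0 .zero fun f _ h0 => by simp [h0 z hz]
    rw [map_neg, Complex.neg_re] at h2
    linarith
  have hJ : ∀ z ∈ J, F z = 0 := fun z hz => by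
    apply Complex.ext (hJ0 z hz)
    simpa using hJ0 _ (J.smul_mem Complex.I hz)
  have htr : ∀ a b, F (a * b) = F (b * a) := trace_of_star_mul fun a => by
    have h1 := key _ _ (.single a) (QLE.refl _)
    have h2 := key _ _ (.single (star a)) (QLE.refl _)
    rw [star_star] at h2
    rw [map_sub, Complex.sub_re] at h1 h2
    apply Complex.ext (by linarith)
    rw [hpos.im_eq_zero (.star_mul_self a), hpos.im_eq_zero (.mul_star_self a)]
  have h1 := h F hpos htr hJ
  have h2 := hF _ (smul_sub_mem_strictlyBelowComm .zero (QLE.refl 0) le_rfl hδ)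
  simp only [hp, map_sub, IsPos.apply_real_smul, Complex.sub_re, Complex.re_ofReal_mul, smul_zero,
    map_zero, Complex.zero_re] at h2
  linarith

/-- An element whose ideal is everything modulo `J` dominates the unit after conjugations. -/
theorem exists_one_le_sum (h1 : (1 : A) ∈ principalIdeal d ⊔ J)
    (hdpos : ∃ g : A, d = star g * g) :
    ∃ (ι : Type) (_ : Fintype ι) (w : ι → A), QLE J 1 (∑ i, star (w i) * d * w i) := by
  let _ := CStarAlgebra.spectralOrder A
  have _ := CStarAlgebra.spectralOrderedRing A
  obtain ⟨g, rfl⟩ := hdpos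
  have key : ∀ p ∈ principalIdeal (star g * g), ∀ k : ℂ, ∃ (ι : Type) (_ : Fintype ι) (w : ι → A),
      QLE J (k • p) (∑ i, star (w i) * (star g * g) * w i) := by
    intro p hp
    induction hp using Submodule.span_induction with
    | mem p hp =>
      obtain ⟨a, b, rfl⟩ := hp
      intro k
      refine ⟨Bool, inferInstance, fun i => if i then star (k • a) else b, fun f hf _ => ?_⟩
      have h2 := (Complex.le_def.mp (hf (g * star (k • a) - g * b))).1
      have h3 := (Complex.le_def.mp (hf (g * star (k • a)))).1
      have h4 := (Complex.le_def.mp (hf (g * b))).1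
      have h5 : (f (star b * (star g * (g * star (k • a))))).re
          = (f ((k • a) * (star g * (g * b)))).re := by
        have := hf.apply_star ((k • a) * (star g * (g * b)))
        simp only [star_mul, star_star, mul_assoc] at this
        rw [this]; simp
      simp only [star_mul, star_star, star_sub, mul_sub, sub_mul, map_sub, mul_assoc,
        Complex.sub_re, Complex.zero_re, h5] at h2 h3 h4
      simp only [Fintype.sum_bool, map_add, if_true, Complex.add_re, star_star, mul_assoc,
        Bool.false_eq_true, if_false, ← smul_mul_assoc]
      linarith
    | zero => exact fun k => ⟨Empty, inferInstance, fun i => i.elim, by simpa using QLE.refl 0⟩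
    | add p q _ _ hp hq =>
      intro k
      obtain ⟨ι, _, w, hw⟩ := hp k
      obtain ⟨ι', _, w', hw'⟩ := hq k
      exact ⟨ι ⊕ ι', inferInstance, Sum.elim w w', by simpa using hw.add hw'⟩
    | smul r p _ hp =>
      intro k
      simpa [smul_smul] using hp (k * r)
  obtain ⟨p, hp, j, hj, hpj⟩ := Submodule.mem_sup.mp h1
  obtain ⟨ι, _, w, hw⟩ := key p hp 1
  refine ⟨ι, inferInstance, w, QLE.trans (fun f _ h0 => ?_) hw⟩
  rw [← hpj, map_add, h0 j hj, one_smul, add_zero]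

variable [PartialOrder A] [StarOrderedRing A]

theorem CPRel.cancel (hJ : IsIdeal J) (hc : 0 ≤ c) (hd : 0 ≤ d) (hs : 0 ≤ s)
    (h : CPRel J Set.univ (c + s) (d + s)) {δ : ℝ} (hδ : 0 < δ) :
    CPRel J Set.univ c (d + δ • (1 : A)) := by
  have key : ∀ n : ℕ, CPRel J Set.univ ((n : ℝ) • c + s) ((n : ℝ) • d + s) := fun n => by
    induction n with
    | zero => simpa using CPRel.refl hs
    | succ n ih =>
      have h1 := (CPRel.refl (J := J) hc).add ih
      have h2 := (CPRel.refl (J := J) (smul_nonneg (Nat.cast_nonneg (α := ℝ) n) hd)).add h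
      have e1 : c + ((n : ℝ) • d + s) = (n : ℝ) • d + (c + s) := by abel
      rw [e1] at h1
      convert (h1.trans hJ h2).mono_set (Set.subset_univ _) using 1 <;> push_cast <;> module
  obtain ⟨n, hn⟩ := exists_nat_gt (‖s‖ / δ)
  have hn0 : (0 : ℝ) < n := (div_nonneg (norm_nonneg s) hδ.le).trans_lt hn
  refine CPRel.of_smul hn0 (CPRel.mono_left (QLE.of_le (le_add_of_nonneg_right hs))
    ((key n).mono_right (QLE.of_le ?_)))
  rw [smul_add, smul_smul]
  gcongr
  refine (IsSelfAdjoint.of_nonneg hs).le_algebraMap_norm_self.trans ?_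
  rw [Algebra.algebraMap_eq_smul_one]
  refine smul_le_smul_of_nonneg_right ?_ zero_le_one
  rw [div_lt_iff₀ hδ] at hn
  exact hn.le

/-- Comparison of positive elements by traces. -/
theorem CPRel.of_traces (hJ : IsIdeal J) (hc : 0 ≤ c) (hd : 0 ≤ d)
    (h : ∀ τ : A →L[ℂ] ℂ, IsPos τ → (∀ a b, τ (a * b) = τ (b * a)) → (∀ z ∈ J, τ z = 0) →
      (τ c).re ≤ (τ d).re) {δ : ℝ} (hδ : 0 < δ) :
    CPRel J Set.univ c (d + δ • (1 : A)) := by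
  obtain ⟨w, ⟨ι, _, x, rfl⟩, hw⟩ := exists_isCommSum h (half_pos hδ)
  set d' : A := d + (δ / 2) • (1 : A) with hd'
  have hd0 : 0 ≤ d' := add_nonneg hd (smul_nonneg (half_pos hδ).le zero_le_one)
  have hsq : IsSelfAdjoint (CFC.sqrt d') := .of_nonneg (CFC.sqrt_nonneg d')
  have hrel : CPRel J Set.univ (c + ∑ i, x i * star (x i)) (d' + ∑ i, x i * star (x i)) := by
    refine CPRel.of_eq (ι := Option ι) (x := fun i => i.elim (CFC.sqrt d') x)
      (fun _ => trivial) ?_ ?_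
    · simp only [Fintype.sum_option, Option.elim, hsq.star_eq, CFC.sqrt_mul_sqrt_self d']
      convert hw.add (QLE.refl (∑ i, x i * star (x i))) using 1
      rw [Finset.sum_sub_distrib]
      abel
    · simp only [Fintype.sum_option, Option.elim, hsq.star_eq, CFC.sqrt_mul_sqrt_self d']
      exact QLE.refl _
  have := hrel.cancel hJ hc hd0 (Finset.sum_nonneg fun i _ => mul_star_self_nonneg (x i))
    (half_pos hδ)
  rwa [hd', add_assoc, ← add_smul, add_halves] at this

/-- Comparison of `γ ^ 2` and `g ^ 2` implemented by elements of `g A γ`. -/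
theorem CPRel.of_traces_of_full {γ g : A} (hJ : IsIdeal J) (hγ : IsSelfAdjoint γ)
    (hg : IsSelfAdjoint g) (hfull : (1 : A) ∈ principalIdeal (g * g) ⊔ J)
    (h : ∀ τ : A →L[ℂ] ℂ, IsPos τ → (∀ a b, τ (a * b) = τ (b * a)) → (∀ z ∈ J, τ z = 0) →
      (τ (γ * γ)).re ≤ (τ (g * g)).re) {ε : ℝ} (hε : 0 < ε) :
    CPRel J {x | ∃ r, x = g * r * γ} (γ * γ) ((1 + ε) • (g * g)) := by
  obtain ⟨ι, _, w, hw⟩ := exists_one_le_sum hfull ⟨g, by rw [hg.star_eq]⟩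
  set C : ℝ := ∑ i, ‖w i‖ * ‖w i‖ with hC
  have hC0 : 0 ≤ C := Finset.sum_nonneg fun i _ => mul_self_nonneg _
  set δ : ℝ := ε / (C + 1) with hδ
  have hδ0 : 0 < δ := by positivity
  have hδC : δ * C ≤ ε := by
    rw [hδ, div_mul_eq_mul_div, div_le_iff₀ (by positivity)]
    nlinarith
  have hγγ : 0 ≤ γ * γ := by simpa [hγ.star_eq] using star_mul_self_nonneg γ
  have hgg : 0 ≤ g * g := by simpa [hg.star_eq] using star_mul_self_nonneg g
  have h1 := CPRel.of_traces hJ hγγ hgg h hδ0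
  have h2 : CPRel J {x | ∃ r, x = g * r} (g * g + δ • (1 : A)) ((1 + ε) • (g * g)) := by
    refine CPRel.of_eq (ι := Option ι) (x := fun i => i.elim g fun i => g * (√δ • w i))
      (fun i => ?_) ?_ ?_
    · cases i with
      | none => exact ⟨1, by simp⟩
      | some i => exact ⟨_, rfl⟩
    · simp only [Fintype.sum_option, Option.elim, hg.star_eq, star_mul, star_smul, star_trivial]
      refine (QLE.refl _).add ?_
      convert hw.smul hδ0.le using 1
      rw [Finset.smul_sum]
      refine Finset.sum_congr rfl fun i _ => ?_
      rw [mul_smul_comm, smul_mul_assoc, smul_mul_assoc, mul_smul_comm, smul_smul,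
        Real.mul_self_sqrt hδ0.le]
      simp only [mul_assoc]
    · simp only [Fintype.sum_option, Option.elim, hg.star_eq, star_mul, star_smul, star_trivial]
      refine QLE.of_le ?_
      rw [add_smul, one_smul]
      gcongr
      have hi : ∀ i ∈ Finset.univ, g * √δ • w i * (√δ • star (w i) * g)
          ≤ (δ * (‖w i‖ * ‖w i‖)) • (g * g) := fun i _ => by
        have hle : w i * star (w i) ≤ (‖w i‖ * ‖w i‖) • (1 : A) := by
          have := (IsSelfAdjoint.mul_star_self (w i)).le_algebraMap_norm_self
          rwa [Algebra.algebraMap_eq_smul_one, CStarRing.norm_self_mul_star] at this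
        have := smul_le_smul_of_nonneg_left (star_left_conjugate_le_conjugate hle g) hδ0.le
        rw [hg.star_eq] at this
        convert this using 1
        · rw [mul_smul_comm, smul_mul_assoc, smul_mul_assoc, mul_smul_comm, smul_smul,
            Real.mul_self_sqrt hδ0.le]
          simp only [mul_assoc]
        · rw [mul_smul_comm, smul_mul_assoc, smul_smul, mul_one]
      refine (Finset.sum_le_sum hi).trans ?_
      rw [← Finset.sum_smul, ← Finset.mul_sum]
      exact smul_le_smul_of_nonneg_right hδC hgg
  have h3 := ((CPRel.refl_mul_self (J := J) hγ).trans hJ h1).trans hJ h2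
  refine h3.mono_set ?_
  rintro _ ⟨y, ⟨r', rfl⟩, r, x, ⟨y', -, r'', x', rfl, rfl⟩, rfl⟩
  exact ⟨r' * r * y' * r'', by simp only [mul_assoc]⟩

end Comparison

section SecondVariation

variable {J : Submodule ℂ A} {b h x y : A} {σ : A →L[ℂ] ℂ}

/-- The second variation `-[h, [h, b]]` of the unitary conjugates of `b` in the direction `h`. -/
def secondVariation (b h : A) : A := (2 : ℝ) • (h * b * h) - h * h * b - b * (h * h)

/-- Nonnegativity of the second variation at the functional `σ`. -/
def Stationary (σ : A →L[ℂ] ℂ) (b : A) : Prop :=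
  ∀ h : A, IsSelfAdjoint h → 0 ≤ (σ (secondVariation b h)).re

theorem Stationary.two_sided (hσ : Stationary σ b) (x : A) :
    0 ≤ (σ ((2 : ℝ) • (x * b * star x) + (2 : ℝ) • (star x * b * x)
      - b * (x * star x + star x * x) - (x * star x + star x * x) * b)).re := by
  have h1 := hσ (x + star x) (by rw [isSelfAdjoint_iff]; simp [add_comm])
  have h2 := hσ (Complex.I • (x - star x)) (by
    rw [isSelfAdjoint_iff]; simp [star_smul, smul_sub]; abel)
  have key : secondVariation b (x + star x) + secondVariation b (Complex.I • (x - star x))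
      = (2 : ℝ) • ((2 : ℝ) • (x * b * star x) + (2 : ℝ) • (star x * b * x)
      - b * (x * star x + star x * x) - (x * star x + star x * x) * b) := by
    simp only [secondVariation, mul_smul_comm, smul_mul_assoc, smul_smul, Complex.I_mul_I, neg_smul,
      one_smul, mul_add, add_mul, mul_sub, sub_mul, smul_add, smul_sub, mul_neg, neg_mul, smul_neg,
      mul_assoc]
    module
  have h3 : 0 ≤ (σ (secondVariation b (x + star x)
      + secondVariation b (Complex.I • (x - star x)))).re := by
    rw [map_add, Complex.add_re]; exact add_nonneg h1 h2
  rw [key, IsPos.apply_real_smul, Complex.re_ofReal_mul] at h3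
  linarith

theorem Stationary.sub_smul_one (hσ : Stationary σ b) (t : ℝ) :
    Stationary σ (b - t • (1 : A)) := fun h hh => by
  have : secondVariation (b - t • (1 : A)) h = secondVariation b h := by
    simp only [secondVariation, mul_sub, sub_mul, mul_smul_comm, smul_mul_assoc, mul_one, one_mul]
    module
  rw [this]
  exact hσ h hh

theorem exp_smul_eq_cfc (hb : IsSelfAdjoint b) (r : ℝ) :
    NormedSpace.exp (r • b) = cfc (fun s : ℝ => Real.exp (r * s)) b := by
  rw [← CFC.real_exp_eq_normedSpace_exp ((IsSelfAdjoint.all r).smul hb), ← cfc_comp_smul r Real.exp b]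
  rfl

theorem norm_exp_mul_sqrt_le (hb : IsSelfAdjoint b) {r : ℝ} (hr : 0 < r) :
    ‖NormedSpace.exp (r • b) * cfc (fun s : ℝ => √(max (-s) 0)) b‖ ≤ √r⁻¹ := by
  rw [exp_smul_eq_cfc hb, ← cfc_mul _ _ b]
  refine norm_cfc_le (Real.sqrt_nonneg _) fun s _ => ?_
  rw [Real.norm_of_nonneg (by positivity)]
  refine Real.le_sqrt_of_sq_le ?_
  rw [mul_pow, Real.sq_sqrt (le_max_right _ _)]
  rcases le_total 0 s with hs | hs
  · rw [max_eq_right (by linarith), mul_zero]; positivity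
  · rw [max_eq_left (by linarith), ← Real.exp_nat_mul, ← one_div, le_div_iff₀ hr]
    have h1 := Real.add_one_le_exp (-((2 : ℕ) * (r * s)))
    have h2 : Real.exp ((2 : ℕ) * (r * s)) * Real.exp (-((2 : ℕ) * (r * s))) = 1 := by
      rw [← Real.exp_add, add_neg_cancel, Real.exp_zero]
    have h3 := Real.exp_pos ((2 : ℕ) * (r * s))
    push_cast at h1 h2 h3 ⊢
    nlinarith [mul_le_mul_of_nonneg_left h1 h3.le, mul_nonneg hr.le (neg_nonneg.mpr hs)]

/-- Conjugating by `exp (r • b)` shows that a stationary functional decreases along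
`x ↦ (star x * x, x * star x)` for `x` moving upwards in the spectral order of `b`. -/
theorem Stationary.re_star_mul_self_le (hpos : IsPos σ) (hσ : Stationary σ b)
    (hb : IsSelfAdjoint b)
    (hx : x = cfc (fun s : ℝ => √(max (-s) 0)) b * y * cfc (fun s : ℝ => √(max s 0)) b) :
    (σ (star x * x)).re ≤ (σ (x * star x)).re := by
  let _ := CStarAlgebra.spectralOrder A
  have _ := CStarAlgebra.spectralOrderedRing A
  set E : ℝ → A := fun r => NormedSpace.exp (r • b) with hE
  set E' : ℝ → A := fun r => NormedSpace.exp (r • (-b)) with hE'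
  have hEsa : ∀ r, star (E r) = E r := fun r => by
    simp only [hE, exp_smul_eq_cfc hb]; exact (IsSelfAdjoint.cfc).star_eq
  have hEsa' : ∀ r, star (E' r) = E' r := fun r => by
    simp only [hE', exp_smul_eq_cfc hb.neg]; exact (IsSelfAdjoint.cfc).star_eq
  have hd : ∀ r, HasDerivAt E (b * E r) r := fun r => hasDerivAt_exp_smul_const' b r
  have hd2 : ∀ r, HasDerivAt E (E r * b) r := fun r => hasDerivAt_exp_smul_const b r
  have hd' : ∀ r, HasDerivAt E' (E' r * (-b)) r := fun r => hasDerivAt_exp_smul_const (-b) r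
  have hd2' : ∀ r, HasDerivAt E' ((-b) * E' r) r := fun r => hasDerivAt_exp_smul_const' (-b) r
  set X : ℝ → A := fun r => E r * x * E' r with hX
  set Y : ℝ → A := fun r => E' r * star x * E r with hY
  have hXY : ∀ r, star (X r) = Y r := fun r => by
    simp [hX, hY, hEsa, hEsa', mul_assoc]
  have hX0 : X 0 = x := by simp [hX, hE, hE']
  have hXd : ∀ r, HasDerivAt X (b * X r - X r * b) r := fun r => by
    refine (((hd r).mul_const x).mul (hd' r)).congr_deriv ?_
    simp only [hX]; noncomm_ring
  have hYd : ∀ r, HasDerivAt Y (Y r * b - b * Y r) r := fun r => by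
    refine (((hd2' r).mul_const (star x)).mul (hd2 r)).congr_deriv ?_
    simp only [hY]; noncomm_ring
  set F : ℝ → ℝ := fun r => (σ (X r * Y r - Y r * X r)).re with hF
  have hFd : ∀ r, HasDerivAt F
      (-(σ ((2 : ℝ) • (X r * b * star (X r)) + (2 : ℝ) • (star (X r) * b * X r)
      - b * (X r * star (X r) + star (X r) * X r)
      - (X r * star (X r) + star (X r) * X r) * b)).re) r := fun r => by
    have h1 := ((hXd r).mul (hYd r)).sub ((hYd r).mul (hXd r))
    refine ((Complex.reCLM.comp (σ.restrictScalars ℝ)).hasFDerivAt.comp_hasDerivAt r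
      h1).congr_deriv ?_
    rw [hXY, ← Complex.neg_re, ← map_neg]
    change (σ _).re = _
    congr 2
    simp only [two_smul]
    noncomm_ring
  have hanti : Antitone F := antitone_of_deriv_nonpos (fun r => (hFd r).differentiableAt) fun r => by
    rw [(hFd r).deriv, neg_nonpos]
    exact hσ.two_sided _
  have hnorm : ∀ r : ℝ, 0 < r → ‖X r‖ ≤ r⁻¹ * ‖y‖ := fun r hr => by
    have h1 := norm_exp_mul_sqrt_le hb hr
    have h2 := norm_exp_mul_sqrt_le hb.neg hr
    rw [← cfc_comp_neg _ b] at h2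
    simp only [neg_neg] at h2
    have e1 : X r = (E r * cfc (fun s : ℝ => √(max (-s) 0)) b) * y *
        (cfc (fun s : ℝ => √(max s 0)) b * E' r) := by
      simp only [hX, hx, mul_assoc]
    rw [← norm_star, star_mul, (IsSelfAdjoint.cfc (f := fun s : ℝ => √(max s 0)) (a := b)).star_eq]
      at h2
    change ‖_ * star (E' r)‖ ≤ _ at h2
    rw [hEsa'] at h2
    rw [e1]
    calc _ ≤ √r⁻¹ * ‖y‖ * √r⁻¹ := by
          refine (norm_mul_le _ _).trans ?_
          gcongr
          refine (norm_mul_le _ _).trans ?_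
          gcongr
      _ = r⁻¹ * ‖y‖ := by
          rw [mul_right_comm, Real.mul_self_sqrt (inv_pos.mpr hr).le]
  have hlim : Filter.Tendsto (fun r : ℝ => -((r⁻¹ * ‖y‖) * (r⁻¹ * ‖y‖) * (σ 1).re)) Filter.atTop
      (nhds 0) := by
    have h1 : Filter.Tendsto (fun r : ℝ => r⁻¹ * ‖y‖) Filter.atTop (nhds (0 * ‖y‖)) :=
      tendsto_inv_atTop_zero.mul_const _
    simpa using ((h1.mul h1).mul_const (σ 1).re).neg
  have hF0 : 0 ≤ F 0 := by
    refine le_of_tendsto hlim (Filter.eventually_atTop.mpr ⟨1, fun r hr => ?_⟩)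
    have hr0 : 0 < r := by linarith
    refine le_trans ?_ (hanti hr0.le)
    have h1 := hpos.re_nonneg (mul_star_self_nonneg (X r))
    have h2 := hpos.re_le_norm (star (X r) * X r)
    have h3 := mul_self_le_mul_self (norm_nonneg _) (hnorm r hr0)
    have h4 := mul_le_mul_of_nonneg_right h3 hpos.one_nonneg
    rw [CStarRing.norm_star_mul_self] at h2
    simp only [hF, ← hXY, map_sub, Complex.sub_re]
    linarith
  simp only [hF, ← hXY, hX0, map_sub, Complex.sub_re] at hF0
  linarith

/-- A stationary functional cannot exceed all traces on an element with full negative part. -/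
theorem Stationary.re_nonpos (hJ : IsIdeal J) (hpos : IsPos σ) (h0 : ∀ z ∈ J, σ z = 0)
    (hσ : Stationary σ b) (hb : IsSelfAdjoint b)
    (hfull : (1 : A) ∈ principalIdeal (below b 0) ⊔ J)
    (htr : ∀ τ : A →L[ℂ] ℂ, IsPos τ → (∀ a b, τ (a * b) = τ (b * a)) → (∀ z ∈ J, τ z = 0) →
      (τ b).re ≤ 0) : (σ b).re ≤ 0 := by
  let _ := CStarAlgebra.spectralOrder A
  have _ := CStarAlgebra.spectralOrderedRing A
  set γ : A := cfc (fun s : ℝ => √(max s 0)) b with hγ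
  set g : A := cfc (fun s : ℝ => √(max (-s) 0)) b with hg
  have hγγ : γ * γ = above b 0 := by
    rw [hγ, above, ← cfc_mul _ _ b]
    exact cfc_congr fun s _ => by simp [Real.mul_self_sqrt]
  have hgg : g * g = below b 0 := by
    rw [hg, below, ← cfc_mul _ _ b]
    exact cfc_congr fun s _ => by simp [Real.mul_self_sqrt]
  have hbd : b = γ * γ - g * g := by rw [hγγ, hgg, above_sub_below hb]; simp
  have hle : ∀ f : A →L[ℂ] ℂ, (f b).re ≤ 0 ↔ (f (γ * γ)).re ≤ (f (g * g)).re := fun f => by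
    conv_lhs => rw [hbd, map_sub, Complex.sub_re, sub_nonpos]
  rw [hle]
  refine le_of_forall_pos_le_add fun ε hε => ?_
  set η : ℝ := ε / ((σ 1).re + (σ (g * g)).re + 1) with hη
  have hs1 := hpos.one_nonneg
  have hs2 : 0 ≤ (σ (g * g)).re := by rw [hgg]; exact hpos.re_nonneg (below_nonneg b 0)
  have hη0 : 0 < η := by positivity
  have hηε : η * ((σ 1).re + (σ (g * g)).re) ≤ ε := by
    rw [hη, div_mul_eq_mul_div, div_le_iff₀ (by positivity)]
    nlinarith
  obtain ⟨ι, _, x, hx, h1, h2⟩ := CPRel.of_traces_of_full (γ := γ) (g := g) hJ IsSelfAdjoint.cfc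
    IsSelfAdjoint.cfc (by rwa [hgg]) (fun τ h h' h'' => (hle τ).mp (htr τ h h' h'')) hη0 η hη0
  have h3 := h1 σ hpos h0
  have h4 := h2 σ hpos h0
  have h5 : (σ (∑ i, star (x i) * x i)).re ≤ (σ (∑ i, x i * star (x i))).re := by
    simp only [map_sum, Complex.re_sum]
    refine Finset.sum_le_sum fun i _ => ?_
    obtain ⟨y, hy⟩ := hx i
    exact hσ.re_star_mul_self_le hpos hb hy
  simp only [map_sub, IsPos.apply_real_smul, Complex.sub_re, Complex.re_ofReal_mul] at h3 h4
  linarith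

end SecondVariation

section CentralFibres

variable {b : A} {σ ρ : A →L[ℂ] ℂ} {M : Submodule ℂ A}

theorem below_sub_smul_one (hb : IsSelfAdjoint b) (t : ℝ) :
    below (b - t • (1 : A)) 0 = below b t := by
  have h1 : b - t • (1 : A) = cfc (fun s : ℝ => s - t) b := by
    rw [cfc_sub _ _ b, cfc_id' ℝ b, cfc_const t b, Algebra.algebraMap_eq_smul_one]
  rw [h1, below, below, ← cfc_comp' (fun s : ℝ => max (0 - s) 0) (fun s : ℝ => s - t) b]
  simp

theorem WeaklyCentral.one_mem_sup (hw : WeaklyCentral A) {χ : A →L[ℂ] ℂ} (h1 : χ 1 = 1)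
    (hM : IsMaximalClosedIdeal M) (hle : centralIdeal χ ≤ M) {d : A} (hd : d ∉ M) :
    (1 : A) ∈ principalIdeal d ⊔ centralIdeal χ := by
  by_contra h
  obtain ⟨M', hM', hle'⟩ :=
    ((isIdeal_principalIdeal d).sup (isIdeal_centralIdeal χ)).exists_maximal h
  have hz : (M : Set A) ∩ Set.center A = (M' : Set A) ∩ Set.center A := by
    ext z
    refine and_congr_left fun hz => ?_
    rw [SetLike.mem_coe, SetLike.mem_coe, hM.mem_iff_of_centralIdeal h1 hle hz,
      hM'.mem_iff_of_centralIdeal h1 (le_sup_right.trans hle') hz]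
  rw [hw M M' hM hM' hz] at hd
  exact hd (hle' (Submodule.mem_sup_left (mem_principalIdeal d)))

theorem Stationary.below_mem (hw : WeaklyCentral A) {χ : A →L[ℂ] ℂ} (h1 : χ 1 = 1)
    (hM : IsMaximalClosedIdeal M) (hle : centralIdeal χ ≤ M) (hpos : IsPos σ) (hσ1 : σ 1 = 1)
    (h0 : ∀ z ∈ centralIdeal χ, σ z = 0) (hσ : Stationary σ b) (hb : IsSelfAdjoint b) {t : ℝ}
    (ht : t < (σ b).re)
    (htr : ∀ τ : A →L[ℂ] ℂ, IsPos τ → (∀ a b, τ (a * b) = τ (b * a)) →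
      (∀ z ∈ centralIdeal χ, τ z = 0) → (τ b).re ≤ t * (τ 1).re) : below b t ∈ M := by
  by_contra hmem
  have h2 := (hσ.sub_smul_one t).re_nonpos (isIdeal_centralIdeal χ) hpos h0
    (hb.sub ((IsSelfAdjoint.all t).smul (.one A)))
    (by rw [below_sub_smul_one hb]; exact hw.one_mem_sup h1 hM hle hmem)
    fun τ k1 k2 k3 => by
      rw [map_sub, IsPos.apply_real_smul, Complex.sub_re, Complex.re_ofReal_mul]
      linarith [htr τ k1 k2 k3]
  rw [map_sub, IsPos.apply_real_smul, Complex.sub_re, Complex.re_ofReal_mul, hσ1,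
    Complex.one_re] at h2
  linarith

theorem IsPos.re_smul_isTracialState {τ : A →L[ℂ] ℂ} (hτ : IsPos τ)
    (htr : ∀ a b, τ (a * b) = τ (b * a)) (h : 0 < (τ 1).re) :
    IsTracialState (((τ 1).re⁻¹ : ℂ) • τ) := by
  let _ := CStarAlgebra.spectralOrder A
  have _ := CStarAlgebra.spectralOrderedRing A
  have hc : τ 1 = ((τ 1).re : ℂ) := Complex.ext rfl (by simpa using hτ.im_one)
  refine isTracialState_of_isPos (fun a => ?_) ?_ fun a b => ?_
  · refine mul_nonneg ?_ (hτ a)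
    rw [← Complex.ofReal_inv]; exact_mod_cast (inv_pos.mpr h).le
  · change ((τ 1).re⁻¹ : ℂ) * τ 1 = 1
    nth_rw 2 [hc]
    exact inv_mul_cancel₀ (by exact_mod_cast h.ne')
  · change ((τ 1).re⁻¹ : ℂ) * τ (a * b) = ((τ 1).re⁻¹ : ℂ) * τ (b * a)
    rw [htr]

/-- On a fibre over the centre, stationary states for `b` and `-b` are ordered on `b`. -/
theorem Stationary.re_le_re (hw : WeaklyCentral A) (hG : GlimmTraceCondition A)
    {χ : A →L[ℂ] ℂ} (h1 : χ 1 = 1) (hM : IsMaximalClosedIdeal M) (hle : centralIdeal χ ≤ M)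
    (hσp : IsPos σ) (hσ1 : σ 1 = 1) (hσ0 : ∀ z ∈ centralIdeal χ, σ z = 0) (hσ : Stationary σ b)
    (hρp : IsPos ρ) (hρ1 : ρ 1 = 1) (hρ0 : ∀ z ∈ centralIdeal χ, ρ z = 0)
    (hρ : Stationary ρ (-b)) (hb : IsSelfAdjoint b) : (σ b).re ≤ (ρ b).re := by
  let _ := CStarAlgebra.spectralOrder A
  have _ := CStarAlgebra.spectralOrderedRing A
  by_contra! hlt
  obtain ⟨t₁, ht₁, ht₁'⟩ := exists_between hlt
  obtain ⟨t₂, ht₂, ht₂'⟩ := exists_between ht₁'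
  have hbelow := hσ.below_mem hw h1 hM hle hσp hσ1 hσ0 hb ht₂'
  have habove := hρ.below_mem (t := -t₁) hw h1 hM hle hρp hρ1 hρ0 hb.neg
    (by rw [map_neg, Complex.neg_re]; linarith)
  rw [below_neg hb] at habove
  by_cases hex : ∃ τ : A →L[ℂ] ℂ, IsTracialState τ ∧ ∀ z ∈ centralIdeal χ, τ z = 0
  · obtain ⟨τ, hτ, hτ0⟩ := hex
    have hglimm : ∀ τ' : A →L[ℂ] ℂ, (∀ z ∈ centralIdeal χ, τ' z = 0) →
        ∀ x ∈ glimmSet M, τ' x = 0 := fun τ' h' => apply_eq_zero_of_glimmSet fun z hzM hz y =>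
      h' _ (Submodule.subset_span ⟨z, hz, (hM.mem_iff_of_centralIdeal h1 hle hz).mp hzM, y, rfl⟩)
    have hvan := (hG M hM).2 τ hτ (hglimm τ hτ0)
    have hall : ∀ τ' : A →L[ℂ] ℂ, IsPos τ' → (∀ a b, τ' (a * b) = τ' (b * a)) →
        (∀ z ∈ centralIdeal χ, τ' z = 0) → (τ' b).re = (τ b).re * (τ' 1).re := by
      intro τ' k1 k2 k3
      rcases k1.one_nonneg.eq_or_lt with h | h
      · have : τ' = 0 := by rw [← norm_eq_zero, k1.norm_eq, h]
        simp [this]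
      · have hst := k1.re_smul_isTracialState k2 h
        have := (hG M hM).1 _ τ hst hτ (hglimm _ fun z hz => by
          change ((τ' 1).re⁻¹ : ℂ) * τ' z = 0
          rw [k3 z hz, mul_zero]) (hglimm τ hτ0)
        have h2 : ((τ' 1).re⁻¹ : ℂ) * τ' b = τ b := DFunLike.congr_fun this b
        rw [← h2, ← Complex.ofReal_inv, Complex.re_ofReal_mul]
        field_simp
    rcases lt_or_ge (τ b).re t₂ with hlt2 | hge
    · have hm := hbelow fun τ' k1 k2 k3 => by
        rw [hall τ' k1 k2 k3]
        exact mul_le_mul_of_nonneg_right hlt2.le k1.one_nonneg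
      have h2 := hτ.isPos.re_nonneg (above_nonneg b t₂)
      have h3 := congrArg τ (above_sub_below hb t₂)
      rw [map_sub, hvan _ hm, sub_zero] at h3
      rw [h3, map_sub, IsPos.apply_real_smul, Complex.sub_re, Complex.re_ofReal_mul, hτ.map_one,
        Complex.one_re] at h2
      linarith
    · have hm := habove fun τ' k1 k2 k3 => by
        rw [map_neg, Complex.neg_re, hall τ' k1 k2 k3, neg_mul, neg_le_neg_iff]
        exact mul_le_mul_of_nonneg_right (ht₂.le.trans hge) k1.one_nonneg
      have h2 := hτ.isPos.re_nonneg (below_nonneg b t₁)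
      have h3 := congrArg (fun x => (τ x).re) (above_sub_below hb t₁)
      simp only [map_sub, hvan _ hm, IsPos.apply_real_smul, Complex.sub_re, Complex.re_ofReal_mul,
        hτ.map_one, Complex.one_re, Complex.zero_re] at h3
      linarith
  · have hnone : ∀ τ : A →L[ℂ] ℂ, IsPos τ → (∀ a b, τ (a * b) = τ (b * a)) →
        (∀ z ∈ centralIdeal χ, τ z = 0) → τ = 0 := by
      intro τ' k1 k2 k3
      rcases k1.one_nonneg.eq_or_lt with h | h
      · rw [← norm_eq_zero, k1.norm_eq, h]
      exfalso
      refine hex ⟨_, k1.re_smul_isTracialState k2 h, fun z hz => ?_⟩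
      change ((τ' 1).re⁻¹ : ℂ) * τ' z = 0
      rw [k3 z hz, mul_zero]
    have hm1 := hbelow fun τ k1 k2 k3 => by simp [hnone τ k1 k2 k3]
    have hm2 := habove fun τ k1 k2 k3 => by simp [hnone τ k1 k2 k3]
    have hge : (t₂ - t₁) • (1 : A) ≤ above b t₁ + below b t₂ := by
      rw [above, below, ← cfc_add b _ _, ← Algebra.algebraMap_eq_smul_one, ← cfc_const _ b]
      refine cfc_mono fun s _ => ?_
      linarith [le_max_left (s - t₁) 0, le_max_left (t₂ - s) 0]
    obtain ⟨u, hu⟩ := CStarAlgebra.isUnit_of_le _ hge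
      (IsStrictlyPositive.smul (sub_pos.mpr ht₂) isStrictlyPositive_one)
    have h1M := (hM.isIdeal (↑u⁻¹ : A) _ (M.add_mem hm2 hm1)).1
    rw [← hu, Units.inv_mul] at h1M
    exact hM.one_notMem h1M

end CentralFibres

section ExtremePairs

variable {b : A}

theorem Stationary.weight [PartialOrder A] [StarOrderedRing A] {σ : A →L[ℂ] ℂ}
    (hσ : Stationary σ b) {z : A} (hz : z ∈ Set.center A) (h0 : 0 ≤ z) :
    Stationary (weight σ z) b := fun h hh => by
  set k : A := cfc (fun s : ℝ => √s) z with hk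
  have hkc : k ∈ Set.center A := cfc_mem_center hz _
  have hksa : IsSelfAdjoint k := IsSelfAdjoint.cfc
  have hkk : k * k = z := by
    rw [hk, ← cfc_mul _ _ z]
    conv_rhs => rw [← cfc_id' ℝ z]
    exact cfc_congr fun s hs => Real.mul_self_sqrt (spectrum_nonneg_of_nonneg h0 hs)
  have hc := mul_comm_of_mem_center hkc
  have hsa : IsSelfAdjoint (k * h) := by
    rw [isSelfAdjoint_iff, star_mul, hksa.star_eq, hh.star_eq, hc]
  have key : z * secondVariation b h = secondVariation b (k * h) := by
    have e1 : ∀ x y : A, k * h * x * (k * y) = k * k * (h * x * y) := fun x y => by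
      rw [← mul_assoc, ← hc, mul_assoc k h x]
      simp only [mul_assoc]
    have e2 : k * h * (k * h) = k * k * (h * h) := by simpa using e1 1 h
    rw [secondVariation, secondVariation, e1, e2, mul_sub, mul_sub, mul_smul_comm, hkk,
      mul_assoc z (h * h) b, ← mul_assoc b z, ← mul_comm_of_mem_center hz b, mul_assoc z b]
  rw [weight_apply, key]
  exact hσ _ hsa

/-- The normalisation of `x ↦ φ (z * x)`. -/
def normalizedWeight (φ : WeakDual ℂ A) (z : A) : WeakDual ℂ A :=
  (φ z).re⁻¹ • StrongDual.toWeakDual (weight (WeakDual.toStrongDual φ) z)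

theorem normalizedWeight_apply (φ : WeakDual ℂ A) (z x : A) :
    normalizedWeight φ z x = ((φ z).re⁻¹ : ℝ) * φ (z * x) := rfl

theorem re_normalizedWeight_apply (φ : WeakDual ℂ A) (z x : A) :
    (normalizedWeight φ z x).re = (φ z).re⁻¹ * (φ (z * x)).re := by
  rw [normalizedWeight_apply, Complex.re_ofReal_mul]

/-- Pairs of states which agree on the centre and are stationary for `b` and `-b`. -/
def stationaryPairs (b : A) : Set (WeakDual ℂ A × WeakDual ℂ A) :=
  {p | (p.1 ∈ stateSpace A ∧ p.2 ∈ stateSpace A) ∧ (∀ z ∈ Set.center A, p.1 z = p.2 z) ∧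
    Stationary (WeakDual.toStrongDual p.1) b ∧ Stationary (WeakDual.toStrongDual p.2) (-b)}

theorem isCompact_stationaryPairs (b : A) : IsCompact (stationaryPairs b) := by
  have : stationaryPairs b = (stateSpace A ×ˢ stateSpace A) ∩
      ((⋂ z ∈ Set.center A, {p | p.1 z = p.2 z}) ∩
        ((⋂ h : A, ⋂ _ : IsSelfAdjoint h, {p | 0 ≤ (p.1 (secondVariation b h)).re}) ∩
         (⋂ h : A, ⋂ _ : IsSelfAdjoint h, {p | 0 ≤ (p.2 (secondVariation (-b) h)).re}))) := by
    ext p; simp [stationaryPairs, Stationary]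
  have c1 : ∀ x : A, Continuous fun p : WeakDual ℂ A × WeakDual ℂ A => p.1 x := fun x =>
    (WeakDual.eval_continuous x).comp continuous_fst
  have c2 : ∀ x : A, Continuous fun p : WeakDual ℂ A × WeakDual ℂ A => p.2 x := fun x =>
    (WeakDual.eval_continuous x).comp continuous_snd
  rw [this]
  refine (isCompact_stateSpace.prod isCompact_stateSpace).inter_right (.inter ?_ (.inter ?_ ?_))
  · exact isClosed_biInter fun z _ => isClosed_eq (c1 z) (c2 z)
  · exact isClosed_iInter fun h => isClosed_iInter fun _ =>
      isClosed_le continuous_const (Complex.continuous_re.comp (c1 _))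
  · exact isClosed_iInter fun h => isClosed_iInter fun _ =>
      isClosed_le continuous_const (Complex.continuous_re.comp (c2 _))

theorem normalizedWeight_combo {φ : WeakDual ℂ A} (hφ : φ 1 = 1) {z : A}
    (hpos : (φ z).re ≠ 0) (hpos' : 1 - (φ z).re ≠ 0) :
    (φ z).re • normalizedWeight φ z + (1 - (φ z).re) • normalizedWeight φ (1 - z) = φ := by
  have hre : (φ (1 - z)).re = 1 - (φ z).re := by rw [map_sub, hφ]; simp
  refine DFunLike.ext _ _ fun x => ?_
  rw [weakDual_combo_apply, normalizedWeight_apply, normalizedWeight_apply, hre, ← mul_assoc,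
    ← mul_assoc, ← Complex.ofReal_mul, ← Complex.ofReal_mul, mul_inv_cancel₀ hpos,
    mul_inv_cancel₀ hpos', Complex.ofReal_one, one_mul, one_mul, ← map_add, ← add_mul]
  simp

variable [PartialOrder A] [StarOrderedRing A]

theorem normalizedWeight_mem_stateSpace {φ : WeakDual ℂ A} (hφ : φ ∈ stateSpace A) {z : A}
    (hz : z ∈ Set.center A) (h0 : 0 ≤ z) (hpos : 0 < (φ z).re) :
    normalizedWeight φ z ∈ stateSpace A := by
  have hval : φ z = ((φ z).re : ℂ) :=
    Complex.ext rfl (by simpa using hφ.1.im_eq_zero (IsSelfAdjoint.of_nonneg h0))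
  refine ⟨fun a => ?_, ?_⟩
  · rw [WeakDual.toStrongDual_apply, normalizedWeight_apply]
    exact mul_nonneg (by exact_mod_cast (inv_pos.mpr hpos).le) (hφ.1.weight hz h0 a)
  · rw [normalizedWeight_apply, mul_one]
    nth_rw 2 [hval]
    rw [← Complex.ofReal_mul, inv_mul_cancel₀ hpos.ne', Complex.ofReal_one]

theorem stationary_normalizedWeight {φ : WeakDual ℂ A}
    (h : Stationary (WeakDual.toStrongDual φ) b) {z : A}
    (hz : z ∈ Set.center A) (h0 : 0 ≤ z) (hpos : 0 < (φ z).re) :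
    Stationary (WeakDual.toStrongDual (normalizedWeight φ z)) b := fun x hx => by
  rw [WeakDual.toStrongDual_apply, re_normalizedWeight_apply]
  exact mul_nonneg (inv_pos.mpr hpos).le (h.weight hz h0 x hx)

theorem normalizedWeight_mem_stationaryPairs {p : WeakDual ℂ A × WeakDual ℂ A}
    (hp : p ∈ stationaryPairs b) {z : A} (hz : z ∈ Set.center A) (h0 : 0 ≤ z)
    (hpos : 0 < (p.1 z).re) :
    (normalizedWeight p.1 z, normalizedWeight p.2 z) ∈ stationaryPairs b := by
  obtain ⟨⟨h1, h2⟩, h3, h4, h5⟩ := hp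
  have hpos' : 0 < (p.2 z).re := by rwa [← h3 z hz]
  refine ⟨⟨normalizedWeight_mem_stateSpace h1 hz h0 hpos,
    normalizedWeight_mem_stateSpace h2 hz h0 hpos'⟩, fun y hy => ?_,
    stationary_normalizedWeight h4 hz h0 hpos, stationary_normalizedWeight h5 hz h0 hpos'⟩
  simp only [normalizedWeight_apply, h3 z hz, h3 _ (Set.mul_mem_center hz hy)]

theorem extremePoints_stationaryPairs_mul {p : WeakDual ℂ A × WeakDual ℂ A}
    (hp : p ∈ (stationaryPairs b).extremePoints ℝ) :
    (∀ z ∈ Set.center A, ∀ x, p.1 (z * x) = p.1 z * p.1 x) ∧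
      ∀ z ∈ Set.center A, ∀ x, p.2 (z * x) = p.1 z * p.2 x := by
  obtain ⟨⟨⟨h1, h2⟩, h3, -, -⟩, hext⟩ := mem_extremePoints_iff_left.mp hp
  have key : ∀ z ∈ Set.center A, (1 / 3 : ℝ) • (1 : A) ≤ z → z ≤ (2 / 3 : ℝ) • (1 : A) →
      ∀ x, p.1 (z * x) = p.1 z * p.1 x ∧ p.2 (z * x) = p.1 z * p.2 x := by
    intro z hz hlo hup x
    have hlo' : 1 / 3 ≤ (p.1 z).re := by
      have := h1.1.re_mono hlo
      rw [IsPos.apply_real_smul, WeakDual.toStrongDual_apply, WeakDual.toStrongDual_apply,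
        h1.2] at this
      simpa using this
    have hup' : (p.1 z).re ≤ 2 / 3 := by
      have := h1.1.re_mono hup
      rw [IsPos.apply_real_smul, WeakDual.toStrongDual_apply, WeakDual.toStrongDual_apply,
        h1.2] at this
      simpa using this
    have h0 : 0 ≤ z := le_trans (smul_nonneg (by norm_num) zero_le_one) hlo
    have h0' : 0 ≤ 1 - z := sub_nonneg.mpr (hup.trans (by
      conv_rhs => rw [← one_smul ℝ (1 : A)]
      exact smul_le_smul_of_nonneg_right (by norm_num) zero_le_one))
    have hz' := sub_mem_center one_mem_center hz
    have hre' : (p.1 (1 - z)).re = 1 - (p.1 z).re := by rw [map_sub, h1.2]; simp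
    have hval : p.1 z = ((p.1 z).re : ℂ) :=
      Complex.ext rfl (by simpa using h1.1.im_eq_zero (IsSelfAdjoint.of_nonneg h0))
    have hne : ((p.1 z).re : ℂ) ≠ 0 := by norm_cast; linarith
    have heq := hext _ (normalizedWeight_mem_stationaryPairs hp.1 hz h0 (by linarith)) _
      (normalizedWeight_mem_stationaryPairs hp.1 hz' h0' (by linarith))
      ⟨(p.1 z).re, 1 - (p.1 z).re, by linarith, by linarith, by ring, Prod.ext
        (normalizedWeight_combo h1.2 (by linarith) (by linarith)) (by
          rw [h3 z hz]
          rw [h3 z hz] at hlo' hup'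
          exact normalizedWeight_combo h2.2 (by linarith) (by linarith))⟩
    have e1 : normalizedWeight p.1 z x = p.1 x := DFunLike.congr_fun (congrArg Prod.fst heq) x
    have e2 : normalizedWeight p.2 z x = p.2 x := DFunLike.congr_fun (congrArg Prod.snd heq) x
    rw [normalizedWeight_apply] at e1 e2
    rw [← h3 z hz] at e2
    rw [← e1, ← e2]
    nth_rw 1 3 [hval]
    rw [Complex.ofReal_inv, mul_inv_cancel_left₀ hne, mul_inv_cancel_left₀ hne]
    exact ⟨rfl, rfl⟩
  exact ⟨mul_of_scaled (χ := WeakDual.toStrongDual p.1) (g := WeakDual.toStrongDual p.1) h1.2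
      fun z hz hlo hup x => (key z hz hlo hup x).1,
    mul_of_scaled (χ := WeakDual.toStrongDual p.1) (g := WeakDual.toStrongDual p.2) h1.2
      fun z hz hlo hup x => (key z hz hlo hup x).2⟩

/-- Stationary states for `b` and `-b` which agree on the centre are ordered on `b`. -/
theorem re_le_re_of_mem_stationaryPairs (hw : WeaklyCentral A) (hG : GlimmTraceCondition A)
    (hb : IsSelfAdjoint b) {p : WeakDual ℂ A × WeakDual ℂ A} (hp : p ∈ stationaryPairs b) :
    (p.1 b).re ≤ (p.2 b).re := by
  obtain ⟨e, he, hmax⟩ := exists_extremePoint_isMax (isCompact_stationaryPairs b) ⟨p, hp⟩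
    ((reEval b).comp (ContinuousLinearMap.fst ℝ _ _) -
      (reEval b).comp (ContinuousLinearMap.snd ℝ _ _))
  have hle : (p.1 b).re - (p.2 b).re ≤ (e.1 b).re - (e.2 b).re := hmax p hp
  obtain ⟨m1, m2⟩ := extremePoints_stationaryPairs_mul he
  obtain ⟨⟨h1, h2⟩, -, h4, h5⟩ := he.1
  obtain ⟨M, hM, hMle⟩ := exists_maximal_centralIdeal (χ := WeakDual.toStrongDual e.1) h1.2 m1
  have := Stationary.re_le_re hw hG h1.2 hM hMle h1.1 h1.2
    (fun z hz => apply_eq_zero_of_centralIdeal m1 hz) h4 h2.1 h2.2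
    (fun z hz => apply_eq_zero_of_centralIdeal m2 hz) h5 hb
  rw [WeakDual.toStrongDual_apply, WeakDual.toStrongDual_apply] at this
  linarith

end ExtremePairs

section UnitaryRotation

variable {b : A}

theorem stationary_of_minimal {σ : A →L[ℂ] ℂ}
    (hmin : ∀ u : unitary A, (σ b).re ≤ (σ ((u : A) * b * star (u : A))).re) :
    Stationary σ b := fun h hh => by
  set k : A := Complex.I • h with hk
  set E : ℝ → A := fun r => NormedSpace.exp (r • k) with hE
  set E' : ℝ → A := fun r => NormedSpace.exp (r • (-k)) with hE'
  have hstar : ∀ r, star (E r) = E' r := fun r => by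
    simp [hE, hE', NormedSpace.star_exp, hk, star_smul, hh.star_eq]
  have hsk : ∀ r : ℝ, r • k ∈ skewAdjoint A := fun r => by
    rw [skewAdjoint.mem_iff]; simp [hk, star_smul, hh.star_eq]
  let _ : NormedAlgebra ℚ A := .restrictScalars ℚ ℂ A
  have hE0 : ∀ r, E r ∈ unitary A := fun r =>
    NormedSpace.exp_mem_unitary_of_mem_skewAdjoint (hsk r)
  have hd : ∀ r, HasDerivAt E (k * E r) r := fun r => hasDerivAt_exp_smul_const' k r
  have hd' : ∀ r, HasDerivAt E' (E' r * (-k)) r := fun r => hasDerivAt_exp_smul_const (-k) r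
  set X : ℝ → A := fun r => E r * b * E' r with hX
  have hX0 : X 0 = b := by simp [hX, hE, hE']
  have hXd : ∀ r, HasDerivAt X (k * X r - X r * k) r := fun r => by
    refine (((hd r).mul_const b).mul (hd' r)).congr_deriv ?_
    simp only [hX]; noncomm_ring
  have hXd2 : ∀ r, HasDerivAt (fun r => k * X r - X r * k)
      (k * (k * X r - X r * k) - (k * X r - X r * k) * k) r := fun r =>
    ((hXd r).const_mul k).sub ((hXd r).mul_const k)
  set l : A →L[ℝ] ℝ := Complex.reCLM.comp (σ.restrictScalars ℝ) with hl
  have hF : ∀ r, HasDerivAt (fun r => l (X r)) (l (k * X r - X r * k)) r := fun r =>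
    l.hasFDerivAt.comp_hasDerivAt r (hXd r)
  have hF2 : ∀ r, HasDerivAt (fun r => l (k * X r - X r * k))
      (l (k * (k * X r - X r * k) - (k * X r - X r * k) * k)) r := fun r =>
    l.hasFDerivAt.comp_hasDerivAt r (hXd2 r)
  have hderiv : deriv (fun r => l (X r)) = fun r => l (k * X r - X r * k) :=
    funext fun r => (hF r).deriv
  have hMin : ∀ r, l (X 0) ≤ l (X r) := fun r => by
    have := hmin ⟨E r, hE0 r⟩
    rw [hX0]
    simp only [hX, ← hstar]; exact this
  have hd0 : deriv (fun r => l (X r)) 0 = 0 :=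
    IsLocalMin.deriv_eq_zero (Filter.Eventually.of_forall hMin)
  have hkk : k * (k * b - b * k) - (k * b - b * k) * k = secondVariation b h := by
    simp only [hk, secondVariation, smul_mul_assoc, mul_smul_comm, ← smul_sub, smul_smul,
      Complex.I_mul_I, two_smul, neg_smul, one_smul]
    noncomm_ring
  have hdd : deriv (deriv fun r => l (X r)) 0 = (σ (secondVariation b h)).re := by
    rw [hderiv, (hF2 0).deriv, hX0, hkk]; rfl
  by_contra! hneg
  have hmax := isLocalMax_of_deriv_deriv_neg (hdd.trans_lt hneg) hd0 (hF 0).continuousAt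
  have hconst : (fun r => l (X r)) =ᶠ[nhds 0] fun _ => l (X 0) :=
    hmax.mono fun r hr => le_antisymm hr (hMin r)
  have := hconst.deriv.deriv_eq
  rw [hdd] at this
  simp at this
  linarith

/-- The action of a unitary on the weak dual, by `(rotate u φ) x = φ (u * x * star u)`. -/
def rotate (u : unitary A) : WeakDual ℂ A →L[ℝ] WeakDual ℂ A where
  toFun φ := StrongDual.toWeakDual (IsPos.conj (WeakDual.toStrongDual φ) (star (u : A)))
  map_add' φ ψ := DFunLike.ext _ _ fun x => by
    change IsPos.conj _ _ x = IsPos.conj _ _ x + IsPos.conj _ _ x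
    simp
  map_smul' r φ := DFunLike.ext _ _ fun x => by
    change IsPos.conj _ _ x = r • IsPos.conj _ _ x
    simp [weakDual_real_smul_apply]
  cont := WeakDual.continuous_of_continuous_eval fun x => by
    change Continuous fun φ : WeakDual ℂ A => IsPos.conj (WeakDual.toStrongDual φ) _ x
    simp only [IsPos.conj_apply, WeakDual.toStrongDual_apply]
    exact WeakDual.eval_continuous _

theorem rotate_apply (u : unitary A) (φ : WeakDual ℂ A) (x : A) :
    rotate u φ x = φ ((u : A) * x * star (u : A)) := by
  change IsPos.conj _ _ x = _
  rw [IsPos.conj_apply, star_star, WeakDual.toStrongDual_apply]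

theorem rotate_apply_center (u : unitary A) (φ : WeakDual ℂ A) {z : A} (hz : z ∈ Set.center A) :
    rotate u φ z = φ z := by
  rw [rotate_apply, ← mul_comm_of_mem_center hz, mul_assoc, Unitary.mul_star_self_of_mem u.2, mul_one]

theorem rotate_mem_stateSpace (u : unitary A) {φ : WeakDual ℂ A} (hφ : φ ∈ stateSpace A) :
    rotate u φ ∈ stateSpace A :=
  ⟨IsPos.isPos_conj hφ.1 _, (rotate_apply_center u φ one_mem_center).trans hφ.2⟩

theorem exists_stationary {D : Set (WeakDual ℂ A)} (hD : IsCompact D) (hne : D.Nonempty)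
    (hinv : ∀ u, Set.MapsTo (rotate u) D D) (b : A) :
    ∃ φ ∈ D, Stationary (WeakDual.toStrongDual φ) b := by
  obtain ⟨φ, hφ, hmin⟩ := hD.exists_isMinOn hne (reEval b).continuous.continuousOn
  refine ⟨φ, hφ, stationary_of_minimal fun u => ?_⟩
  have h := hmin (hinv u hφ)
  rw [Set.mem_ofPred_eq, reEval_apply, reEval_apply, rotate_apply] at h
  exact h

theorem exists_apply_of_dual (f : WeakDual ℂ A →L[ℂ] ℂ) : ∃ x : A, ∀ φ, f φ = φ x := by
  obtain ⟨x, hx⟩ := LinearMap.dualEmbedding_surjective (topDualPairing ℂ A) f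
  exact ⟨x, fun φ => (DFunLike.congr_fun hx φ).symm⟩

theorem exists_re_separating {D D' : Set (WeakDual ℂ A)} (hD : IsCompact D) (hD' : IsCompact D')
    (hc : Convex ℝ D) (hc' : Convex ℝ D') (hdisj : Disjoint D D') :
    ∃ (x : A) (u v : ℝ), (∀ φ ∈ D, (φ x).re < u) ∧ u < v ∧ ∀ φ ∈ D', v < (φ x).re := by
  have h := RCLike.geometric_hahn_banach_compact_closed (E := WeakDual ℂ A) (𝕜 := ℂ) hc hD
    hc' hD'.isClosed hdisj
  obtain ⟨f, h⟩ := h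
  obtain ⟨x, hx⟩ := exists_apply_of_dual f
  simp only [hx] at h
  exact ⟨x, h⟩

/-- Invariant compact convex sets of states with the same restriction to the centre meet. -/
theorem inter_nonempty_of_rotate (hw : WeaklyCentral A) (hG : GlimmTraceCondition A)
    {D D' : Set (WeakDual ℂ A)} (hD : IsCompact D) (hD' : IsCompact D') (hc : Convex ℝ D)
    (hc' : Convex ℝ D') (hne : D.Nonempty) (hne' : D'.Nonempty)
    (hinv : ∀ u, Set.MapsTo (rotate u) D D) (hinv' : ∀ u, Set.MapsTo (rotate u) D' D')
    (hs : D ⊆ stateSpace A) (hs' : D' ⊆ stateSpace A)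
    (hz : ∀ φ ∈ D, ∀ ψ ∈ D', ∀ z ∈ Set.center A, φ z = ψ z) : (D ∩ D').Nonempty := by
  let _ := CStarAlgebra.spectralOrder A
  have _ := CStarAlgebra.spectralOrderedRing A
  rw [← Set.not_disjoint_iff_nonempty_inter]
  intro hdisj
  obtain ⟨x, u, v, hu, huv, hv⟩ := exists_re_separating hD hD' hc hc' hdisj
  set b : A := (realPart x : A) with hb
  have hbsa : IsSelfAdjoint b := (realPart x).2
  have hre : ∀ φ ∈ stateSpace A, (φ b).re = (φ x).re := fun φ hφ => hφ.1.re_realPart x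
  obtain ⟨φ, hφ, hφb⟩ := exists_stationary hD hne hinv (-b)
  obtain ⟨ψ, hψ, hψb⟩ := exists_stationary hD' hne' hinv' b
  have h1 := re_le_re_of_mem_stationaryPairs hw hG hbsa (p := (ψ, φ))
    ⟨⟨hs' hψ, hs hφ⟩, fun z hz' => (hz φ hφ ψ hψ z hz').symm, hψb, hφb⟩
  have h2 := hu φ hφ
  have h3 := hv ψ hψ
  rw [hre _ (hs hφ), hre _ (hs' hψ)] at h1
  linarith

end UnitaryRotation

section MinimalSets

variable {E ι : Type*} [AddCommGroup E] [Module ℝ E] [TopologicalSpace E]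

/-- Nonempty compact convex sets invariant under the maps `g i`. -/
structure IsInvariantConvex (g : ι → E →ₗ[ℝ] E) (K : Set E) : Prop where
  nonempty : K.Nonempty
  isCompact : IsCompact K
  convex : Convex ℝ K
  mapsTo : ∀ i, Set.MapsTo (g i) K K

theorem IsInvariantConvex.exists_minimal [T2Space E] {g : ι → E →ₗ[ℝ] E} {K : Set E}
    (hK : IsInvariantConvex g K) :
    ∃ K₀ ⊆ K, IsInvariantConvex g K₀ ∧ ∀ S ⊆ K₀, IsInvariantConvex g S → S = K₀ := by
  obtain ⟨K₀, hle, hmin⟩ := zorn_superset_nonempty {S | IsInvariantConvex g S}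
    (fun c hc hchain hne => by
      refine ⟨⋂₀ c, ⟨?_, ?_, ?_, fun i x hx S hS => (hc hS).mapsTo i (hx S hS)⟩,
        fun S hS => Set.sInter_subset_of_mem hS⟩
      · have : Nonempty c := hne.to_subtype
        exact IsCompact.nonempty_sInter_of_directed_nonempty_isCompact_isClosed 
          (fun S hS T hT => (hchain.total hS hT).elim (fun h => ⟨S, hS, subset_rfl, h⟩)
            fun h => ⟨T, hT, h, subset_rfl⟩)
          (fun S hS => (hc hS).nonempty) (fun S hS => (hc hS).isCompact)
          fun S hS => (hc hS).isCompact.isClosed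
      · obtain ⟨S, hS⟩ := hne
        exact (hc hS).isCompact.of_isClosed_subset
          (isClosed_sInter fun S hS => (hc hS).isCompact.isClosed) (Set.sInter_subset_of_mem hS)
      · exact convex_sInter fun S hS => (hc hS).convex) K hK
  exact ⟨K₀, hle, hmin.prop, fun S hS h => hmin.eq_of_subset h hS⟩

theorem IsInvariantConvex.image {F : Type*} [AddCommGroup F] [Module ℝ F] [TopologicalSpace F]
    {g : ι → E →ₗ[ℝ] E} {g' : ι → F →ₗ[ℝ] F} {K : Set E} (hK : IsInvariantConvex g K)
    (l : E →L[ℝ] F) (hl : ∀ i x, l (g i x) = g' i (l x)) : IsInvariantConvex g' (l '' K) where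
  nonempty := hK.nonempty.image l
  isCompact := hK.isCompact.image l.continuous
  convex := hK.convex.linear_image l.toLinearMap
  mapsTo := by
    rintro i _ ⟨x, hx, rfl⟩
    exact ⟨g i x, hK.mapsTo i hx, hl i x⟩

theorem IsInvariantConvex.inter_preimage {F : Type*} [AddCommGroup F] [Module ℝ F]
    [TopologicalSpace F] [T2Space F] {g : ι → E →ₗ[ℝ] E} {g' : ι → F →ₗ[ℝ] F} {K : Set E}
    {D : Set F} (hK : IsInvariantConvex g K) (hD : IsInvariantConvex g' D)
    (l : E →L[ℝ] F) (hl : ∀ i x, l (g i x) = g' i (l x)) (hne : (K ∩ l ⁻¹' D).Nonempty) :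
    IsInvariantConvex g (K ∩ l ⁻¹' D) where
  nonempty := hne
  isCompact := hK.isCompact.inter_right (hD.isCompact.isClosed.preimage l.continuous)
  convex := hK.convex.inter (hD.convex.linear_preimage l.toLinearMap)
  mapsTo i x hx := ⟨hK.mapsTo i hx.1, by
    rw [Set.mem_preimage, hl]; exact hD.mapsTo i hx.2⟩

/-- The image of a minimal set is minimal. -/
theorem IsInvariantConvex.minimal_image {F : Type*} [AddCommGroup F] [Module ℝ F]
    [TopologicalSpace F] [T2Space F] {g : ι → E →ₗ[ℝ] E} {g' : ι → F →ₗ[ℝ] F} {K : Set E}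
    (hK : IsInvariantConvex g K) (hmin : ∀ S ⊆ K, IsInvariantConvex g S → S = K)
    (l : E →L[ℝ] F) (hl : ∀ i x, l (g i x) = g' i (l x)) {D : Set F} (hDK : D ⊆ l '' K)
    (hD : IsInvariantConvex g' D) : D = l '' K := by
  obtain ⟨y, hy⟩ := hD.nonempty
  obtain ⟨x, hx, rfl⟩ := hDK hy
  have h := hmin _ Set.inter_subset_left (hK.inter_preimage hD l hl ⟨x, hx, hy⟩)
  refine hDK.antisymm ?_
  rintro _ ⟨z, hz, rfl⟩
  rw [← h] at hz
  exact hz.2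

end MinimalSets

section Orbits

/-- The diagonal action of a unitary on pairs of functionals. -/
def rotatePair (u : unitary A) :
    WeakDual ℂ A × WeakDual ℂ A →ₗ[ℝ] WeakDual ℂ A × WeakDual ℂ A :=
  (rotate u).toLinearMap.prodMap (rotate u).toLinearMap

theorem rotatePair_apply (u : unitary A) (p : WeakDual ℂ A × WeakDual ℂ A) :
    rotatePair u p = (rotate u p.1, rotate u p.2) := rfl

/-- Pairs of states with central restriction `φ` which differ by at least `δ` along the unitary
orbit of `a`. -/
def separatedPairs (φ : WeakDual ℂ A) (a : A) (δ : ℝ) : Set (WeakDual ℂ A × WeakDual ℂ A) :=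
  {p | (p.1 ∈ stateSpace A ∧ p.2 ∈ stateSpace A) ∧
    (∀ z ∈ Set.center A, p.1 z = φ z ∧ p.2 z = φ z) ∧
    ∀ u : unitary A, δ ≤ (p.1 ((u : A) * a * star (u : A))).re -
      (p.2 ((u : A) * a * star (u : A))).re}

theorem isInvariantConvex_separatedPairs {φ : WeakDual ℂ A} {a : A} {δ : ℝ}
    (hne : (separatedPairs φ a δ).Nonempty) :
    IsInvariantConvex rotatePair (separatedPairs φ a δ) where
  nonempty := hne
  isCompact := by
    have : separatedPairs φ a δ = (stateSpace A ×ˢ stateSpace A) ∩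
        ((⋂ z ∈ Set.center A, {p | p.1 z = φ z ∧ p.2 z = φ z}) ∩
          (⋂ u : unitary A, {p | δ ≤ (p.1 ((u : A) * a * star (u : A))).re -
            (p.2 ((u : A) * a * star (u : A))).re})) := by
      ext p; simp [separatedPairs]
    have c1 : ∀ x : A, Continuous fun p : WeakDual ℂ A × WeakDual ℂ A => p.1 x := fun x =>
      (WeakDual.eval_continuous x).comp continuous_fst
    have c2 : ∀ x : A, Continuous fun p : WeakDual ℂ A × WeakDual ℂ A => p.2 x := fun x =>
      (WeakDual.eval_continuous x).comp continuous_snd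
    rw [this]
    refine (isCompact_stateSpace.prod isCompact_stateSpace).inter_right (.inter ?_ ?_)
    · exact isClosed_biInter fun z _ => (isClosed_eq (c1 z) continuous_const).inter
        (isClosed_eq (c2 z) continuous_const)
    · exact isClosed_iInter fun u => isClosed_le continuous_const
        ((Complex.continuous_re.comp (c1 _)).sub (Complex.continuous_re.comp (c2 _)))
  convex := by
    rintro p ⟨⟨p1, p2⟩, p3, p4⟩ q ⟨⟨q1, q2⟩, q3, q4⟩ s t hs ht hst
    have hst' : (s : ℂ) + t = 1 := by exact_mod_cast hst
    refine ⟨⟨convex_stateSpace p1 q1 hs ht hst, convex_stateSpace p2 q2 hs ht hst⟩,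
      fun z hz => ⟨?_, ?_⟩, fun u => ?_⟩
    · rw [Prod.fst_add, Prod.smul_fst, Prod.smul_fst, weakDual_combo_apply, (p3 z hz).1,
        (q3 z hz).1, ← add_mul, hst', one_mul]
    · rw [Prod.snd_add, Prod.smul_snd, Prod.smul_snd, weakDual_combo_apply, (p3 z hz).2,
        (q3 z hz).2, ← add_mul, hst', one_mul]
    · rw [Prod.fst_add, Prod.smul_fst, Prod.smul_fst, Prod.snd_add, Prod.smul_snd, Prod.smul_snd,
        weakDual_combo_apply, weakDual_combo_apply, Complex.add_re, Complex.add_re,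
        Complex.re_ofReal_mul, Complex.re_ofReal_mul, Complex.re_ofReal_mul, Complex.re_ofReal_mul]
      have h1 := mul_le_mul_of_nonneg_left (p4 u) hs
      have h2 := mul_le_mul_of_nonneg_left (q4 u) ht
      have h3 : δ = s * δ + t * δ := by rw [← add_mul, hst, one_mul]
      linarith
  mapsTo v := by
    rintro p ⟨⟨p1, p2⟩, p3, p4⟩
    rw [rotatePair_apply]
    refine ⟨⟨rotate_mem_stateSpace v p1, rotate_mem_stateSpace v p2⟩, fun z hz => ?_, fun u => ?_⟩
    · rw [rotate_apply_center _ _ hz, rotate_apply_center _ _ hz]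
      exact p3 z hz
    · have := p4 (v * u)
      simp only [Submonoid.coe_mul, star_mul] at this
      simp only [rotate_apply]
      simpa only [mul_assoc] using this

/-- States which agree on the centre come arbitrarily close on some unitary conjugate of `a`. -/
theorem separatedPairs_eq_empty (hw : WeaklyCentral A) (hG : GlimmTraceCondition A)
    (φ : WeakDual ℂ A) (a : A) {δ : ℝ} (hδ : 0 < δ) : separatedPairs φ a δ = ∅ := by
  rw [← Set.not_nonempty_iff_eq_empty]
  intro hne
  obtain ⟨K, hKle, hK, hmin⟩ := (isInvariantConvex_separatedPairs hne).exists_minimal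
  set l1 := ContinuousLinearMap.fst ℝ (WeakDual ℂ A) (WeakDual ℂ A)
  set l2 := ContinuousLinearMap.snd ℝ (WeakDual ℂ A) (WeakDual ℂ A)
  set g : unitary A → WeakDual ℂ A →ₗ[ℝ] WeakDual ℂ A := fun u => (rotate u).toLinearMap
  have h1 : IsInvariantConvex g (l1 '' K) := hK.image l1 fun i x => rfl
  have h2 : IsInvariantConvex g (l2 '' K) := hK.image l2 fun i x => rfl
  have hinter : (l1 '' K ∩ l2 '' K).Nonempty := by
    refine inter_nonempty_of_rotate hw hG h1.isCompact h2.isCompact h1.convex h2.convex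
      h1.nonempty h2.nonempty h1.mapsTo h2.mapsTo ?_ ?_ ?_
    · rintro _ ⟨p, hp, rfl⟩
      exact (hKle hp).1.1
    · rintro _ ⟨p, hp, rfl⟩
      exact (hKle hp).1.2
    · rintro _ ⟨p, hp, rfl⟩ _ ⟨q, hq, rfl⟩ z hz
      exact ((hKle hp).2.1 z hz).1.trans ((hKle hq).2.1 z hz).2.symm
  have hI : IsInvariantConvex g (l1 '' K ∩ l2 '' K) :=
    ⟨hinter, h1.isCompact.inter h2.isCompact, h1.convex.inter h2.convex,
      fun i x hx => ⟨h1.mapsTo i hx.1, h2.mapsTo i hx.2⟩⟩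
  have e1 := hK.minimal_image hmin l1 (fun i x => rfl) Set.inter_subset_left hI
  have e2 := hK.minimal_image hmin l2 (fun i x => rfl) Set.inter_subset_right hI
  have e12 : l2 '' K = l1 '' K := e2.symm.trans e1
  set m := (2⁻¹ : ℝ) • (l1 + l2) with hm
  have hmp : ∀ p, m p = (2⁻¹ : ℝ) • p.1 + (2⁻¹ : ℝ) • p.2 := fun p =>
    smul_add (2⁻¹ : ℝ) (l1 p) (l2 p)
  have hmid : IsInvariantConvex g (m '' K) := hK.image m fun u x => by
    rw [hmp, hmp, map_add, map_smul, map_smul]; rfl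
  have e3 : m '' K = l1 '' K := by
    refine hK.minimal_image hmin l1 (fun i x => rfl) ?_ hmid
    rintro _ ⟨p, hp, rfl⟩
    rw [hmp]
    exact h1.convex ⟨p, hp, rfl⟩ (e12 ▸ ⟨p, hp, rfl⟩) (by norm_num) (by norm_num) (by norm_num)
  have hext := h1.isCompact.extremePoints_nonempty h1.nonempty
  obtain ⟨e, he⟩ := hext
  obtain ⟨hemem, hext⟩ := mem_extremePoints.mp he
  rw [← e3] at hemem
  obtain ⟨p, hp, hpe⟩ := hemem
  rw [hmp] at hpe
  have := hext p.1 ⟨p, hp, rfl⟩ p.2 (e12 ▸ ⟨p, hp, rfl⟩)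
    ⟨2⁻¹, 2⁻¹, by norm_num, by norm_num, by norm_num, hpe⟩
  have h3 := (hKle hp).2.2 1
  rw [this.1, this.2, sub_self] at h3
  linarith

end Orbits

section Averaging

variable {a : A}

theorem isClosed_center : IsClosed (Set.center A) := by
  rw [← Set.centralizer_univ]
  exact Set.isClosed_centralizer _

/-- The unitary orbit of `a`. -/
def unitaryOrbit (a : A) : Set A := {b : A | ∃ u : unitary A, b = (u : A) * a * star (u : A)}

theorem convexHull_unitaryOrbit_subset {S : Set A} (hS : Convex ℝ S)
    (h : ∀ u : unitary A, (u : A) * a * star (u : A) ∈ S) : convexHull ℝ (unitaryOrbit a) ⊆ S :=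
  convexHull_min (by rintro _ ⟨u, rfl⟩; exact h u) hS

theorem conj_mem_convexHull {b : A} (hb : b ∈ convexHull ℝ (unitaryOrbit a)) (u : unitary A) :
    (u : A) * b * star (u : A) ∈ convexHull ℝ (unitaryOrbit a) := by
  have hS : Convex ℝ {b : A | (u : A) * b * star (u : A) ∈ convexHull ℝ (unitaryOrbit a)} := by
    intro x hx y hy s t hs ht hst
    have := convex_convexHull ℝ (unitaryOrbit a) hx hy hs ht hst
    simpa only [Set.mem_ofPred_eq, mul_add, add_mul, mul_smul_comm, smul_mul_assoc] using this
  refine convexHull_unitaryOrbit_subset hS (fun v => ?_) hb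
  refine subset_convexHull ℝ _ ⟨u * v, ?_⟩
  simp only [Submonoid.coe_mul, star_mul, mul_assoc]

/-- Linear maps which send every element into the convex hull of its unitary orbit. -/
def IsAveraging (α : A →ₗ[ℂ] A) : Prop := ∀ x, α x ∈ convexHull ℝ (unitaryOrbit x)

theorem IsAveraging.comp {α β : A →ₗ[ℂ] A} (hα : IsAveraging α) (hβ : IsAveraging β) :
    IsAveraging (α ∘ₗ β) := fun x =>
  convexHull_unitaryOrbit_subset (convex_convexHull ℝ _) (conj_mem_convexHull (hβ x)) (hα (β x))

theorem IsAveraging.norm_le {α : A →ₗ[ℂ] A} (hα : IsAveraging α) (x : A) : ‖α x‖ ≤ ‖x‖ := by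
  have := convexHull_unitaryOrbit_subset (convex_closedBall (0 : A) ‖x‖) (fun u => by
    simp [← Unitary.coe_star]) (hα x)
  simpa using this

theorem IsAveraging.apply_center {α : A →ₗ[ℂ] A} (hα : IsAveraging α) {z : A}
    (hz : z ∈ Set.center A) : α z = z :=
  convexHull_unitaryOrbit_subset (convex_singleton z) (fun u => by
    rw [Set.mem_singleton_iff, ← mul_comm_of_mem_center hz, mul_assoc,
      Unitary.mul_star_self_of_mem u.2, mul_one]) (hα z)

theorem isSelfAdjoint_of_mem_convexHull (ha : IsSelfAdjoint a) {b : A}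
    (hb : b ∈ convexHull ℝ (unitaryOrbit a)) : IsSelfAdjoint b :=
  convexHull_unitaryOrbit_subset (S := {b | IsSelfAdjoint b})
    (fun _ hx _ hy s t _ _ _ => ((IsSelfAdjoint.all s).smul hx).add ((IsSelfAdjoint.all t).smul hy))
    (fun u => ha.conjugate (u : A)) hb

theorem exists_isAveraging {b : A} (hb : b ∈ convexHull ℝ (unitaryOrbit a)) :
    ∃ α : A →ₗ[ℂ] A, IsAveraging α ∧ α a = b := by
  refine convexHull_unitaryOrbit_subset (S := {b | ∃ α : A →ₗ[ℂ] A, IsAveraging α ∧ α a = b})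
    ?_ (fun u => ?_) hb
  · rintro _ ⟨α, hα, rfl⟩ _ ⟨β, hβ, rfl⟩ s t hs ht hst
    exact ⟨s • α + t • β, fun x => convex_convexHull ℝ _ (hα x) (hβ x) hs ht hst, rfl⟩
  · exact ⟨LinearMap.mulLeft ℂ (u : A) ∘ₗ LinearMap.mulRight ℂ (star (u : A)), fun x =>
      subset_convexHull ℝ _ ⟨u, by simp [mul_assoc]⟩, by simp [mul_assoc]⟩

theorem mem_dixmierSet_of_tendsto {x : ℕ → A} {z : A}
    (hx : ∀ n, x n ∈ convexHull ℝ (unitaryOrbit a)) (h : Filter.Tendsto x Filter.atTop (nhds z)) :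
    z ∈ dixmierSet a :=
  mem_closure_of_tendsto h (Filter.Eventually.of_forall hx)

/-- Successive approximation by elements of the centre. -/
theorem dixmierProperty_of_isAveraging
    (h : ∀ a : A, ∀ ε > 0, ∃ α : A →ₗ[ℂ] A, IsAveraging α ∧ ∃ z ∈ Set.center A, ‖α a - z‖ < ε) :
    DixmierProperty A := by
  intro a
  choose! α hα z hz hlt using h
  let x : ℕ → A := fun n => Nat.rec a (fun n y => α y ((1 / 2) ^ n) y) n
  have hx : ∀ n, x (n + 1) = α (x n) ((1 / 2) ^ n) (x n) := fun n => rfl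
  have hpos : ∀ n : ℕ, (0 : ℝ) < (1 / 2) ^ n := fun n => by positivity
  have hmem : ∀ n, x n ∈ convexHull ℝ (unitaryOrbit a) := fun n => by
    induction n with
    | zero => exact subset_convexHull ℝ _ ⟨1, by simp [x]⟩
    | succ n ih =>
      exact convexHull_unitaryOrbit_subset (convex_convexHull ℝ _) (conj_mem_convexHull ih)
        (hα (x n) _ (hpos n) (x n))
  set c : ℕ → A := fun n => z (x n) ((1 / 2) ^ n) with hc
  have hc0 : ∀ n, c n ∈ Set.center A := fun n => hz _ _ (hpos n)
  have h1 : ∀ n, ‖x (n + 1) - c n‖ ≤ (1 / 2) ^ n := fun n => (hlt (x n) _ (hpos n)).le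
  have h2 : ∀ n, ‖x (n + 2) - c n‖ ≤ (1 / 2) ^ n := fun n => by
    have hav := hα (x (n + 1)) _ (hpos (n + 1))
    have := hav.norm_le (x (n + 1) - c n)
    rw [map_sub, hav.apply_center (hc0 n), ← hx (n + 1)] at this
    exact this.trans (h1 n)
  have hcau : CauchySeq fun n => x (n + 1) :=
    cauchySeq_of_le_geometric (1 / 2) 2 (by norm_num) fun n => by
      rw [dist_eq_norm]
      have := norm_sub_le (x (n + 1) - c n) (x (n + 2) - c n)
      rw [sub_sub_sub_cancel_right] at this
      linarith [h1 n, h2 n]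
  obtain ⟨y, hy⟩ := cauchySeq_tendsto_of_complete hcau
  refine ⟨y, mem_dixmierSet_of_tendsto (fun n => hmem (n + 1)) hy, ?_⟩
  have hlim : Filter.Tendsto c Filter.atTop (nhds y) := by
    have h0 : Filter.Tendsto (fun n => x (n + 1) - c n) Filter.atTop (nhds 0) :=
      squeeze_zero_norm h1 (tendsto_pow_atTop_nhds_zero_of_lt_one (by norm_num) (by norm_num))
    simpa using hy.sub h0
  exact isClosed_center.mem_of_tendsto hlim (Filter.Eventually.of_forall hc0)

/-- Approximation of self-adjoint elements suffices. -/
theorem dixmierProperty_of_selfAdjoint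
    (h : ∀ a : A, IsSelfAdjoint a → ∀ ε > 0,
      ∃ b ∈ convexHull ℝ (unitaryOrbit a), ∃ z ∈ Set.center A, ‖b - z‖ < ε) :
    DixmierProperty A := by
  refine dixmierProperty_of_isAveraging fun a ε hε => ?_
  obtain ⟨_, hb, z, hz, hbz⟩ := h (realPart a) (realPart a).2 (ε / 2) (half_pos hε)
  obtain ⟨α, hα, rfl⟩ := exists_isAveraging hb
  obtain ⟨_, hd, w, hw, hdw⟩ := h (α (imaginaryPart a))
    (isSelfAdjoint_of_mem_convexHull (imaginaryPart a).2 (hα _)) (ε / 2) (half_pos hε)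
  obtain ⟨β, hβ, rfl⟩ := exists_isAveraging hd
  refine ⟨β ∘ₗ α, hβ.comp hα, z + Complex.I • w,
    Set.add_mem_center hz (smul_mem_center Complex.I hw), ?_⟩
  have h1 : β (α a) - (z + Complex.I • w) =
      β (α (realPart a) - z) + Complex.I • (β (α (imaginaryPart a)) - w) := by
    conv_lhs => rw [← realPart_add_I_smul_imaginaryPart a]
    rw [map_add, map_add, map_smul, map_smul, map_sub, hβ.apply_center hz, smul_sub]
    abel
  rw [LinearMap.comp_apply, h1]
  calc _ ≤ ‖α (realPart a) - z‖ + ‖β (α (imaginaryPart a)) - w‖ := by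
        refine (norm_add_le _ _).trans (add_le_add (hβ.norm_le _) ?_)
        rw [norm_smul, Complex.norm_I, one_mul]
    _ < ε := by linarith

end Averaging

section Separation

/-- Functionals with equal central restriction, one of which exceeds the other by a positive amount
along the unitary orbit of `a`, give a pair of states with the same property. -/
theorem separatedPairs_nonempty {f g : A →L[ℂ] ℂ} (hf : IsPos f) (hg : IsPos g)
    (hz : ∀ z ∈ Set.center A, f z = g z) {a : A} {δ : ℝ} (hδ : 0 < δ)
    (h : ∀ u : unitary A, δ ≤ (f ((u : A) * a * star (u : A))).re -
      (g ((u : A) * a * star (u : A))).re) :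
    ∃ (φ : WeakDual ℂ A) (δ' : ℝ), 0 < δ' ∧ (separatedPairs φ a δ').Nonempty := by
  let _ := CStarAlgebra.spectralOrder A
  have _ := CStarAlgebra.spectralOrderedRing A
  have h1 : f 1 = g 1 := hz 1 one_mem_center
  set c : ℝ := (f 1).re with hc
  have hfc : f 1 = c := Complex.ext rfl (by simpa using hf.im_one)
  have hc0 : 0 < c := by
    refine lt_of_le_of_ne hf.one_nonneg fun h0 => ?_
    have e1 : f = 0 := by rw [← norm_eq_zero, hf.norm_eq, ← hc, ← h0]
    have e2 : g = 0 := by rw [← norm_eq_zero, hg.norm_eq, ← h1, ← hc, ← h0]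
    have := h 1
    simp [e1, e2] at this
    linarith
  have hcinv : ((c⁻¹ : ℝ) : ℂ) * c = 1 := by
    rw [← Complex.ofReal_mul, inv_mul_cancel₀ hc0.ne', Complex.ofReal_one]
  have hnn : (0 : ℂ) ≤ ((c⁻¹ : ℝ) : ℂ) := by exact_mod_cast (inv_pos.mpr hc0).le
  set N : (A →L[ℂ] ℂ) → WeakDual ℂ A := fun k =>
    StrongDual.toWeakDual (((c⁻¹ : ℝ) : ℂ) • k) with hN
  have hNa : ∀ k x, N k x = ((c⁻¹ : ℝ) : ℂ) * k x := fun k x => rfl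
  have hs : ∀ k : A →L[ℂ] ℂ, IsPos k → k 1 = c → N k ∈ stateSpace A := fun k hk hk1 =>
    ⟨fun x => mul_nonneg hnn (hk x), by rw [hNa, hk1, hcinv]⟩
  refine ⟨N f, c⁻¹ * δ, mul_pos (inv_pos.mpr hc0) hδ, (N f, N g),
    ⟨hs f hf hfc, hs g hg (h1 ▸ hfc)⟩, fun z hz' => ⟨rfl, ?_⟩, fun u => ?_⟩
  · rw [hNa, hNa, hz z hz']
  · rw [hNa, hNa, Complex.re_ofReal_mul, Complex.re_ofReal_mul, ← mul_sub]
    exact mul_le_mul_of_nonneg_left (h u) (inv_pos.mpr hc0).le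

variable [PartialOrder A] [StarOrderedRing A]

theorem norm_le_of_neg_le_of_le {x : A} (hx : IsSelfAdjoint x) {c d : ℝ}
    (hc : x ≤ algebraMap ℝ A c) (hd : -x ≤ algebraMap ℝ A d) (hcd : 0 ≤ max c d) :
    ‖x‖ ≤ max c d := by
  rw [← cfc_id' ℝ x]
  refine norm_cfc_le hcd fun s hs => ?_
  have h1 := (le_algebraMap_iff_spectrum_le hx).mp hc s hs
  have h2 : algebraMap ℝ A (-d) ≤ x := by rw [map_neg]; exact neg_le.mp hd
  have h3 := (algebraMap_le_iff_le_spectrum hx).mp h2 s hs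
  rw [Real.norm_eq_abs, abs_le]
  exact ⟨by linarith [le_max_right c d], h1.trans (le_max_left c d)⟩

/-- Elements with nonpositive real part. -/
def negativeRealPart (A : Type*) [CStarAlgebra A] [PartialOrder A] : Set A :=
  {x | ∃ h p : A, IsSelfAdjoint h ∧ 0 ≤ p ∧ x = Complex.I • h - p}

theorem convex_negativeRealPart : Convex ℝ (negativeRealPart A) := by
  rintro _ ⟨h, p, hh, hp, rfl⟩ _ ⟨k, q, hk, hq, rfl⟩ s t hs ht -
  refine ⟨s • h + t • k, s • p + t • q,
    ((IsSelfAdjoint.all s).smul hh).add ((IsSelfAdjoint.all t).smul hk),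
    add_nonneg (smul_nonneg hs hp) (smul_nonneg ht hq), ?_⟩
  rw [smul_add, smul_comm Complex.I s, smul_comm Complex.I t]
  module

theorem le_algebraMap_norm_of_negativeRealPart {x w y : A} (hx : IsSelfAdjoint x)
    (hy : y ∈ negativeRealPart A) (h : w + y = x) : x ≤ algebraMap ℝ A ‖w‖ := by
  obtain ⟨k, p, hk, hp, rfl⟩ := hy
  have h1 : x = (realPart w : A) - p := by
    rw [← hx.coe_realPart, ← h, map_add, map_sub, realPart_I_smul, hk.imaginaryPart,
      neg_zero, zero_sub, AddSubgroup.coe_add, AddSubgroup.coe_neg,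
      (IsSelfAdjoint.of_nonneg hp).coe_realPart, sub_eq_add_neg]
  rw [h1]
  refine (sub_le_self _ hp).trans ((realPart w).2.le_algebraMap_norm_self.trans ?_)
  exact algebraMap_mono A (realPart.norm_le w)

theorem eq_zero_of_forall_mul_le {d c : ℝ} (h : ∀ t : ℝ, t * d ≤ c) : d = 0 := by
  by_contra hd
  have := h ((c + 1) / d)
  rw [div_mul_cancel₀ _ hd] at this
  linarith

theorem isPos_of_negativeRealPart {f : A →L[ℂ] ℂ} {c : ℝ}
    (h : ∀ x ∈ negativeRealPart A, (f x).re ≤ c) : IsPos f := by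
  refine .of_re (fun p hp => ?_) fun k hk => ?_
  · by_contra! hneg
    have hc : 0 ≤ c := by simpa using h 0 ⟨0, 0, .zero A, le_rfl, by simp⟩
    have ht : 0 ≤ (c + 1) / -(f p).re := by have := neg_pos.mpr hneg; positivity
    have := h (-(((c + 1) / -(f p).re) • p)) ⟨0, _, .zero A, smul_nonneg ht hp, by simp⟩
    rw [map_neg, IsPos.apply_real_smul, Complex.neg_re, Complex.re_ofReal_mul, ← mul_neg,
      div_mul_cancel₀ _ (neg_pos.mpr hneg).ne'] at this
    linarith
  · refine eq_zero_of_forall_mul_le (c := c) fun t => ?_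
    have := h (Complex.I • (t • k)) ⟨t • k, 0, (IsSelfAdjoint.all t).smul hk, le_rfl, by simp⟩
    rwa [smul_comm, IsPos.apply_real_smul, Complex.re_ofReal_mul] at this

open scoped Pointwise in
theorem exists_norm_sub_lt (hw : WeaklyCentral A) (hG : GlimmTraceCondition A) {a : A}
    (ha : IsSelfAdjoint a) {ε : ℝ} (hε : 0 < ε) :
    ∃ b ∈ convexHull ℝ (unitaryOrbit a), ∃ z ∈ Set.center A, ‖b - z‖ < ε := by
  by_contra! hcon
  set T : Set (A × A) := {p | ∃ b ∈ convexHull ℝ (unitaryOrbit a), ∃ z ∈ Set.center A,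
    IsSelfAdjoint z ∧ p = (b - z, z - b)} with hT
  set V : Set A := Metric.ball (0 : A) ε + negativeRealPart A with hV
  have hVo : IsOpen V := Metric.isOpen_ball.add_right
  have hVc : Convex ℝ V := (convex_ball 0 ε).add convex_negativeRealPart
  have hNV : negativeRealPart A ⊆ V := fun x hx =>
    ⟨0, Metric.mem_ball_self hε, x, hx, zero_add x⟩
  have h0N : (0 : A) ∈ negativeRealPart A := ⟨0, 0, .zero A, le_rfl, by simp⟩
  have hTc : Convex ℝ T := by
    rintro _ ⟨b, hb, z, hz, hzs, rfl⟩ _ ⟨d, hd, w, hw, hws, rfl⟩ s t hs ht hst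
    refine ⟨s • b + t • d, convex_convexHull ℝ _ hb hd hs ht hst, s • z + t • w,
      Set.add_mem_center (real_smul_mem_center s hz) (real_smul_mem_center t hw),
      ((IsSelfAdjoint.all s).smul hzs).add ((IsSelfAdjoint.all t).smul hws), ?_⟩
    ext <;> simp [smul_sub] <;> abel
  have hdisj : Disjoint (V ×ˢ V) T := by
    rw [Set.disjoint_left]
    rintro _ ⟨⟨w, hw', y, hy, h1⟩, ⟨w', hw'', y', hy', h2⟩⟩ ⟨b, hb, z, hz, hzs, rfl⟩
    have hsa := (isSelfAdjoint_of_mem_convexHull ha hb).sub hzs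
    have e1 := le_algebraMap_norm_of_negativeRealPart hsa hy h1
    have e2 := le_algebraMap_norm_of_negativeRealPart (x := -(b - z)) hsa.neg hy'
      (by rw [neg_sub]; exact h2)
    have e3 := norm_le_of_neg_le_of_le hsa e1 e2 ((norm_nonneg w).trans (le_max_left _ _))
    have e4 : max ‖w‖ ‖w'‖ < ε := max_lt (by simpa using hw') (by simpa using hw'')
    exact absurd (hcon b hb z hz) (not_le.mpr (e3.trans_lt e4))
  have hHB := RCLike.geometric_hahn_banach_open (𝕜 := ℂ) (hVc.prod hVc) (hVo.prod hVo) hTc hdisj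
  obtain ⟨F, δ, hFV, hFT⟩ := hHB
  set f : A →L[ℂ] ℂ := F.comp (.inl ℂ A A) with hf
  set g : A →L[ℂ] ℂ := F.comp (.inr ℂ A A) with hg
  have hFfg : ∀ x y, F (x, y) = f x + g y := fun x y => by
    simp [hf, hg, ← map_add]
  have hδ : 0 < δ := by
    have := hFV (0, 0) ⟨hNV h0N, hNV h0N⟩
    rw [hFfg, map_zero, map_zero] at this
    simpa using this
  have hfp : IsPos f := isPos_of_negativeRealPart (c := δ) fun x hx => by
    have := hFV (x, 0) ⟨hNV hx, hNV h0N⟩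
    rw [hFfg, map_zero, add_zero] at this
    exact this.le
  have hgp : IsPos g := isPos_of_negativeRealPart (c := δ) fun x hx => by
    have := hFV (0, x) ⟨hNV h0N, hNV hx⟩
    rw [hFfg, map_zero, zero_add] at this
    exact this.le
  have key : ∀ b ∈ convexHull ℝ (unitaryOrbit a), ∀ z ∈ Set.center A, IsSelfAdjoint z →
      δ ≤ ((f b).re - (g b).re) - ((f z).re - (g z).re) := fun b hb z hz hzs => by
    have := hFT _ ⟨b, hb, z, hz, hzs, rfl⟩
    rw [hFfg, map_sub, map_sub, RCLike.re_eq_complex_re] at this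
    simp only [Complex.add_re, Complex.sub_re] at this
    linarith
  have haa : a ∈ convexHull ℝ (unitaryOrbit a) := subset_convexHull ℝ _ ⟨1, by simp⟩
  have hre : ∀ z ∈ Set.center A, IsSelfAdjoint z → (f z).re = (g z).re := by
    intro z hz hzs
    refine sub_eq_zero.mp (eq_zero_of_forall_mul_le (c := (f a).re - (g a).re - δ) fun t => ?_)
    have := key a haa (t • z) (real_smul_mem_center t hz) ((IsSelfAdjoint.all t).smul hzs)
    rw [IsPos.apply_real_smul, IsPos.apply_real_smul, Complex.re_ofReal_mul,
      Complex.re_ofReal_mul] at this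
    linarith
  have hz : ∀ z ∈ Set.center A, f z = g z := by
    have hsa : ∀ z ∈ Set.center A, IsSelfAdjoint z → f z = g z := fun z hz hzs =>
      Complex.ext (hre z hz hzs) (by rw [hfp.im_eq_zero hzs, hgp.im_eq_zero hzs])
    intro z hz
    rw [← realPart_add_I_smul_imaginaryPart z, map_add, map_add, map_smul, map_smul,
      hsa _ (realPart_mem_center hz) (realPart z).2,
      hsa _ (imaginaryPart_mem_center hz) (imaginaryPart z).2]
  obtain ⟨φ, δ', hδ', hne⟩ := separatedPairs_nonempty hfp hgp hz (a := a) hδ fun u => by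
    simpa using key _ (subset_convexHull ℝ _ ⟨u, rfl⟩) 0 Set.zero_mem_center (.zero A)
  exact hne.ne_empty (separatedPairs_eq_empty hw hG φ a hδ')

end Separation

theorem GlimmTraceCondition.dixmierProperty (hG : GlimmTraceCondition A) (hw : WeaklyCentral A) :
    DixmierProperty A := by
  let _ := CStarAlgebra.spectralOrder A
  have _ := CStarAlgebra.spectralOrderedRing A
  exact dixmierProperty_of_selfAdjoint fun a ha ε hε => exists_norm_sub_lt hw hG ha hε

/-- **Theorem 2.6 / 1.1.**  A unital C*-algebra has the Dixmier property iff it is weakly central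
and satisfies the tracial conditions (ii)(a),(b); equivalently, iff it is weakly central, every
simple quotient `A/M` has at most one tracial state, and every extreme tracial state factors
through a simple quotient.  Tracial states of a quotient `A/I` are identified with tracial states
of `A` vanishing on the closed two-sided ideal `I`. -/
theorem dixmierProperty_characterisation (A : Type*) [CStarAlgebra A] :
    (DixmierProperty A ↔
      (WeaklyCentral A ∧ ∀ M : Submodule ℂ A, IsMaximalClosedIdeal M →
        ((∀ τ₁ τ₂ : A →L[ℂ] ℂ, IsTracialState τ₁ → IsTracialState τ₂ →
            (∀ x ∈ glimmSet M, τ₁ x = 0) → (∀ x ∈ glimmSet M, τ₂ x = 0) → τ₁ = τ₂) ∧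
         (∀ τ : A →L[ℂ] ℂ, IsTracialState τ → (∀ x ∈ glimmSet M, τ x = 0) →
            ∀ x ∈ M, τ x = 0)))) ∧
    (DixmierProperty A ↔
      (WeaklyCentral A ∧
        (∀ M : Submodule ℂ A, IsMaximalClosedIdeal M →
          ∀ τ₁ τ₂ : A →L[ℂ] ℂ, IsTracialState τ₁ → IsTracialState τ₂ →
            (∀ x ∈ M, τ₁ x = 0) → (∀ x ∈ M, τ₂ x = 0) → τ₁ = τ₂) ∧
        (∀ τ : A →L[ℂ] ℂ, IsExtremeTracialState τ →
          ∃ M : Submodule ℂ A, IsMaximalClosedIdeal M ∧ ∀ x ∈ M, τ x = 0))) := by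
  exact ⟨⟨fun h => ⟨h.weaklyCentral, h.glimmTraceCondition⟩,
      fun h => GlimmTraceCondition.dixmierProperty h.2 h.1⟩,
    ⟨fun h => ⟨h.weaklyCentral, h.glimmTraceCondition.simpleTraceCondition⟩,
      fun h => (SimpleTraceCondition.glimmTraceCondition h.2 h.1).dixmierProperty h.1⟩⟩

end
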